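/- arXiv:1708.07921 — 7 statements merged into one kernel-verified Lean document; each statement's English description precedes it below -/
import Mathlib

section
/- For every natural number n ≥ 1, the forgetful map f_n(ℝ²) : PConf_{n+1}(ℝ²) → PConf_n(ℝ²) admits a continuous section. -/
/-- The ordered configuration space of `n` points in `S`. -/
abbrev PConf (n : ℕ) (S : Type*) : Type _ := {x : Fin n → S // Function.Injective x}

/-- The forgetful map `f_n(S)` forgetting the 0th point. -/
def forgetPoint (n : ℕ) {S : Type*} (x : PConf (n + 1) S) : PConf n S :=
  ⟨x.1 ∘ Fin.succ, x.2.comp (Fin.succ_injective n)⟩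

/-- A point of norm larger than that of every point of the family `x`. -/
noncomputable def farPoint {n : ℕ} (x : Fin n → EuclideanSpace ℝ (Fin 2)) :
    EuclideanSpace ℝ (Fin 2) :=
  (1 + ∑ i, ‖x i‖) • EuclideanSpace.single 0 1

theorem continuous_farPoint {n : ℕ} : Continuous (farPoint (n := n)) := by
  unfold farPoint
  fun_prop

theorem norm_lt_norm_farPoint {n : ℕ} (x : Fin n → EuclideanSpace ℝ (Fin 2)) (i : Fin n) :
    ‖x i‖ < ‖farPoint x‖ := by
  have hsum : ‖x i‖ ≤ ∑ j, ‖x j‖ :=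
    Finset.single_le_sum (f := fun j => ‖x j‖) (fun j _ => norm_nonneg _) (Finset.mem_univ i)
  rw [farPoint, norm_smul, PiLp.norm_single, norm_one, mul_one]
  exact (lt_one_add _).trans_le ((add_le_add_right hsum 1).trans (le_abs_self _))

theorem farPoint_notMem_range {n : ℕ} (x : Fin n → EuclideanSpace ℝ (Fin 2)) :
    farPoint x ∉ Set.range x := by
  rintro ⟨i, hi⟩
  exact (norm_lt_norm_farPoint x i).ne (congrArg norm hi)

theorem section_exists_R2 (n : ℕ) (hn : 1 ≤ n) :
    ∃ s : PConf n (EuclideanSpace ℝ (Fin 2)) → PConf (n + 1) (EuclideanSpace ℝ (Fin 2)),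
      Continuous s ∧ ∀ x, forgetPoint n (s x) = x := by
  refine ⟨fun x => ⟨Fin.cons (farPoint x.1) x.1,
    Fin.cons_injective_iff.2 ⟨farPoint_notMem_range x.1, x.2⟩⟩, ?_, fun x => ?_⟩
  · refine Continuous.subtype_mk (continuous_pi fun i => ?_) _
    induction i using Fin.cases with
    | zero => exact continuous_farPoint.comp continuous_subtype_val
    | succ i => exact (continuous_apply i).comp continuous_subtype_val
  · exact Subtype.ext (funext fun _ => rfl)
end

section
/- For every natural number n ≥ 1 and every k ∈ {1,…,n}, there exists a continuous section of f_n(ℝ²) whose image is contained in W_k, i.e. an 'adding a point near x_k' section exists. -/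
/-- The set `W_k`: configurations where the 0th point is at distance from `x_k` less than
half of the minimal distance between the points `x_1, …, x_n`. -/
def Wnear (n : ℕ) {S : Type*} [MetricSpace S] (k : Fin (n + 1)) (x : PConf (n + 1) S) : Prop :=
  ∀ i j : Fin (n + 1), i ≠ 0 → j ≠ 0 → i ≠ j →
    dist (x.1 0) (x.1 k) < dist (x.1 i) (x.1 j) / 2

lemma PConf.continuous_apply {n : ℕ} {S : Type*} [TopologicalSpace S] (i : Fin n) :
    Continuous fun x : PConf n S => x.1 i :=
  (_root_.continuous_apply i).comp continuous_subtype_val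

/-- A continuous positive function on the configuration space bounded by a third of every distance
between two distinct points of the configuration. -/
lemma exists_continuous_pos_le_dist_div_three (n : ℕ) (S : Type*) [MetricSpace S] :
    ∃ r : PConf n S → ℝ, Continuous r ∧ (∀ x, 0 < r x) ∧
      ∀ x i j, i ≠ j → r x ≤ dist (x.1 i) (x.1 j) / 3 := by
  rcases isEmpty_or_nonempty (Fin n) with hn | hn
  · exact ⟨fun _ => 1, continuous_const, fun _ => one_pos, fun _ i => hn.elim i⟩
  refine ⟨fun x => Finset.univ.inf' Finset.univ_nonempty
    (fun p : Fin n × Fin n => if p.1 = p.2 then 1 else dist (x.1 p.1) (x.1 p.2) / 3), ?_, ?_, ?_⟩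
  · refine Continuous.finset_inf'_apply _ fun p _ => ?_
    split_ifs
    · exact continuous_const
    · exact ((PConf.continuous_apply _).dist (PConf.continuous_apply _)).div_const 3
  · intro x
    rw [Finset.lt_inf'_iff]
    intro p _
    split_ifs with h
    · exact one_pos
    · exact div_pos (dist_pos.2 (x.2.ne h)) (by norm_num)
  · intro x i j hij
    refine (Finset.inf'_le _ (Finset.mem_univ (i, j))).trans ?_
    simp [hij]

/-- In a nontrivial real normed space one can continuously add a point near the `k`-th point. -/
lemma exists_section_near {E : Type*} [NormedAddCommGroup E] [NormedSpace ℝ E] [Nontrivial E]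
    (n : ℕ) (k : Fin (n + 1)) (hk : k ≠ 0) :
    ∃ s : PConf n E → PConf (n + 1) E,
      Continuous s ∧ (∀ x, forgetPoint n (s x) = x) ∧ ∀ x, Wnear n k (s x) := by
  obtain ⟨k, rfl⟩ := Fin.exists_succ_eq.2 hk
  obtain ⟨r, hr, hr0, hrd⟩ := exists_continuous_pos_le_dist_div_three n E
  obtain ⟨e, he⟩ := exists_norm_eq E zero_le_one
  have hdist (x : PConf n E) : dist (x.1 k + r x • e) (x.1 k) = r x := by
    simp [norm_smul, he, abs_of_pos (hr0 x)]
  have hne (x : PConf n E) (j : Fin n) : x.1 j ≠ x.1 k + r x • e := by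
    intro h
    have hd := hdist x
    rw [← h] at hd
    have hpos := hr0 x
    by_cases hjk : j = k
    · rw [hjk, dist_self] at hd
      exact hpos.ne hd
    · have := hrd x j k hjk
      linarith
  refine ⟨fun x => ⟨Fin.cons (x.1 k + r x • e) x.1, Fin.cons_injective_iff.2
    ⟨fun ⟨j, hj⟩ => hne x j hj, x.2⟩⟩, ?_, fun x => ?_, fun x i j hi hj hij => ?_⟩
  · refine Continuous.subtype_mk (continuous_pi fun i => ?_) _
    cases i using Fin.cases with
    | zero => exact (PConf.continuous_apply k).add (hr.smul continuous_const)
    | succ i => exact PConf.continuous_apply i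
  · ext i : 2
    simp [forgetPoint]
  · obtain ⟨i, rfl⟩ := Fin.exists_succ_eq.2 hi
    obtain ⟨j, rfl⟩ := Fin.exists_succ_eq.2 hj
    simp only [Fin.cons_zero, Fin.cons_succ, hdist]
    have h := hrd x i j fun h => hij (h ▸ rfl)
    have hpos := hr0 x
    linarith

theorem section_near_xk_exists_R2 (n : ℕ) (hn : 1 ≤ n) (k : Fin (n + 1)) (hk : k ≠ 0) :
    ∃ s : PConf n (EuclideanSpace ℝ (Fin 2)) → PConf (n + 1) (EuclideanSpace ℝ (Fin 2)),
      Continuous s ∧ (∀ x, forgetPoint n (s x) = x) ∧ ∀ x, Wnear n k (s x) :=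
  exists_section_near n k hk
end

section
/- The forgetful map f_2(S²) : PConf_3(S²) → PConf_2(S²) does not admit a continuous section. -/
/-- The unit 2-sphere in `ℝ³`. -/
abbrev Sphere2 : Type _ := (Metric.sphere (0 : EuclideanSpace ℝ (Fin 3)) 1 : Set _)

open Complex in
/-- A continuous function on `ℝ` whose exponential is constant is constant. -/
theorem Continuous.eq_of_exp_eq_const {h : ℝ → ℂ} (hc : Continuous h) {c : ℂ}
    (he : ∀ t, exp (h t) = c) (a b : ℝ) : h a = h b := by
  have hexp : (fun z : ℂ ↦ (⟨_, z.exp_ne_zero⟩ : {z : ℂ // z ≠ 0})) ∘ h =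
      (fun z : ℂ ↦ (⟨_, z.exp_ne_zero⟩ : {z : ℂ // z ≠ 0})) ∘ fun _ ↦ h b := by
    funext t
    simp [he]
  exact congrFun (isCoveringMap_exp.eq_of_comp_eq hc continuous_const hexp b rfl) a

open Complex in
/-- A loop in `ℂ \ {0}` of winding number `1` is not freely homotopic to one of winding
number `-1`. -/
theorem not_homotopic_exp_exp_neg {F : ℝ × ℝ → ℂ} (hF : Continuous F) (hF₀ : ∀ p, F p ≠ 0)
    (hper : ∀ φ, F (2 * Real.pi, φ) = F (0, φ)) {φ₀ φ₁ : ℝ} {c d : ℂ}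
    (h₀ : ∀ θ : ℝ, F (θ, φ₀) = c * exp (θ * I))
    (h₁ : ∀ θ : ℝ, F (θ, φ₁) = d * exp (-(θ * I))) : False := by
  obtain ⟨L, ⟨-, hL⟩, -⟩ := isCoveringMapOn_exp.existsUnique_continuousMap_lifts ⟨F, hF⟩
    (a₀ := (0, 0)) (exp_log (hF₀ _)) hF₀
  replace hL : ∀ p, exp (L p) = F p := congrFun hL
  have hwind := Continuous.eq_of_exp_eq_const
    (h := fun φ ↦ L (2 * Real.pi, φ) - L (0, φ)) (c := 1) (by fun_prop)
    (fun φ ↦ by rw [exp_sub, hL, hL, hper, div_self (hF₀ _)]) φ₀ φ₁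
  have hbottom := Continuous.eq_of_exp_eq_const (h := fun θ ↦ L (θ, φ₀) - θ * I) (c := c)
    (by fun_prop)
    (fun θ ↦ by rw [exp_sub, hL, h₀, mul_div_cancel_right₀ _ (exp_ne_zero _)]) (2 * Real.pi) 0
  have htop := Continuous.eq_of_exp_eq_const (h := fun θ ↦ L (θ, φ₁) - -(θ * I)) (c := d)
    (by fun_prop)
    (fun θ ↦ by rw [exp_sub, hL, h₁, mul_div_cancel_right₀ _ (exp_ne_zero _)]) (2 * Real.pi) 0
  push_cast at hwind hbottom htop
  have hzero : (Real.pi : ℂ) * I = 0 := by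
    linear_combination (1 / 4 : ℂ) * (hwind - hbottom + htop)
  simp [Real.pi_ne_zero] at hzero

theorem Sphere2.sum_sq (x : Sphere2) : x.1 0 ^ 2 + x.1 1 ^ 2 + x.1 2 ^ 2 = 1 := by
  have h := EuclideanSpace.real_norm_sq_eq x.1
  rw [norm_eq_of_mem_sphere x, Fin.sum_univ_three] at h
  linarith

/-- The point of the sphere with longitude `p.1` and colatitude `p.2`. -/
noncomputable def sphericalPoint (p : ℝ × ℝ) : Sphere2 :=
  ⟨!₂[Real.sin p.2 * Real.cos p.1, Real.sin p.2 * Real.sin p.1, Real.cos p.2], by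
    rw [mem_sphere_zero_iff_norm, ← sq_eq_sq₀ (norm_nonneg _) zero_le_one,
      EuclideanSpace.real_norm_sq_eq, Fin.sum_univ_three]
    simp only [Matrix.cons_val]
    linear_combination Real.sin p.2 ^ 2 * Real.sin_sq_add_cos_sq p.1 +
      Real.sin_sq_add_cos_sq p.2⟩

theorem continuous_sphericalPoint : Continuous sphericalPoint := by
  unfold sphericalPoint
  refine Continuous.subtype_mk ((PiLp.continuous_toLp 2 _).comp (continuous_pi fun i ↦ ?_)) _
  fin_cases i <;> simp <;> fun_prop

/-- The coordinates of `v` in the frame of unit tangent vectors in the directions of increasing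
longitude and colatitude, combined into a complex number. -/
noncomputable def tangentCoord (p : ℝ × ℝ) (v : Sphere2) : ℂ :=
  ⟨-v.1 0 * Real.sin p.1 + v.1 1 * Real.cos p.1,
    v.1 0 * (Real.cos p.2 * Real.cos p.1) + v.1 1 * (Real.cos p.2 * Real.sin p.1) -
      v.1 2 * Real.sin p.2⟩

theorem continuous_tangentCoord_comp {g : ℝ × ℝ → Sphere2} (hg : Continuous g) :
    Continuous fun p ↦ tangentCoord p (g p) := by
  have (i : Fin 3) : Continuous fun p ↦ (g p).1 i := by fun_prop
  simp only [tangentCoord, Complex.mk_eq_add_mul_I]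
  fun_prop

/-- A point of the sphere whose tangential component at `sphericalPoint p` vanishes is that point or
its antipode. -/
theorem eq_or_eq_neg_of_tangentCoord_eq_zero {p : ℝ × ℝ} {v : Sphere2}
    (h : tangentCoord p v = 0) : v = sphericalPoint p ∨ v = -sphericalPoint p := by
  obtain ⟨h₁, h₂⟩ := Complex.ext_iff.1 h
  simp only [tangentCoord, Complex.zero_re, Complex.zero_im] at h₁ h₂
  have ha := Real.sin_sq_add_cos_sq p.1
  have hb := Real.sin_sq_add_cos_sq p.2
  have hv := v.sum_sq
  set s := Real.sin p.1
  set c := Real.cos p.1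
  set S := Real.sin p.2
  set C := Real.cos p.2
  obtain ⟨r, hr⟩ : ∃ r, r = v.1 0 * (S * c) + v.1 1 * (S * s) + v.1 2 * C := ⟨_, rfl⟩
  have hx : v.1 0 = r * (S * c) := by
    linear_combination (-s) * h₁ + C * c * h₂ - S * c * hr - v.1 0 * ha
      - (v.1 0 * c + v.1 1 * s) * c * hb
  have hy : v.1 1 = r * (S * s) := by
    linear_combination c * h₁ + C * s * h₂ - S * s * hr - v.1 1 * ha
      - (v.1 0 * c + v.1 1 * s) * s * hb
  have hz : v.1 2 = r * C := by
    linear_combination (-S) * h₂ - C * hr - v.1 2 * hb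
  have hr₂ : r ^ 2 = 1 := by
    rw [hx, hy, hz] at hv
    linear_combination hv - r ^ 2 * S ^ 2 * ha - r ^ 2 * hb
  rcases sq_eq_one_iff.1 hr₂ with rfl | rfl
  · left
    ext i
    fin_cases i <;> simp [sphericalPoint, hx, hy, hz, s, c, S, C]
  · right
    ext i
    fin_cases i <;> simp [sphericalPoint, hx, hy, hz, s, c, S, C]

/-- A continuous self-map of the 2-sphere maps some point to itself or to its antipode. -/
theorem Sphere2.exists_eq_or_eq_neg {g : Sphere2 → Sphere2} (hg : Continuous g) :
    ∃ x, g x = x ∨ g x = -x := by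
  by_contra! hne
  have hpole (φ : ℝ) (hφ : Real.sin φ = 0) (θ : ℝ) :
      sphericalPoint (θ, φ) = sphericalPoint (0, φ) := by
    simp [sphericalPoint, hφ]
  set N := g (sphericalPoint (0, 0))
  set S := g (sphericalPoint (0, Real.pi))
  refine not_homotopic_exp_exp_neg (φ₀ := 0) (φ₁ := Real.pi)
    (c := ⟨N.1 1, N.1 0⟩) (d := ⟨S.1 1, -S.1 0⟩)
    (continuous_tangentCoord_comp (hg.comp continuous_sphericalPoint))
    (fun p hp ↦ (eq_or_eq_neg_of_tangentCoord_eq_zero hp).elim (hne _).1 (hne _).2)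
    (fun φ ↦ by simp [tangentCoord, sphericalPoint]) (fun θ ↦ ?_) (fun θ ↦ ?_)
  · rw [Function.comp_apply, hpole 0 Real.sin_zero]
    apply Complex.ext <;>
      simp [tangentCoord, N, Complex.exp_ofReal_mul_I_re, Complex.exp_ofReal_mul_I_im] <;> ring
  · rw [Function.comp_apply, hpole Real.pi Real.sin_pi, ← neg_mul, ← Complex.ofReal_neg]
    apply Complex.ext <;>
      simp [tangentCoord, S, Complex.exp_ofReal_mul_I_re, Complex.exp_ofReal_mul_I_im,
        -Complex.ofReal_neg] <;> ring

theorem no_section_S2_two_points :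
    ¬ ∃ s : PConf 2 Sphere2 → PConf 3 Sphere2,
        Continuous s ∧ ∀ x, forgetPoint 2 (s x) = x := by
  rintro ⟨s, hs, hsec⟩
  have hne (x : Sphere2) : x ≠ -x := ne_neg_of_mem_unit_sphere ℝ x
  let pair (x : Sphere2) : PConf 2 Sphere2 := ⟨![x, -x], by
    rw [Function.Injective]
    simp [Fin.forall_fin_two, hne, (hne _).symm]⟩
  have hpair : Continuous pair := by
    refine Continuous.subtype_mk (continuous_pi fun i ↦ ?_) _
    fin_cases i <;> simp <;> fun_prop
  have hcoord (x : Sphere2) (i : Fin 2) : (s (pair x)).1 i.succ = (pair x).1 i :=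
    congrFun (congrArg Subtype.val (hsec (pair x))) i
  obtain ⟨x, hx | hx⟩ := Sphere2.exists_eq_or_eq_neg (g := fun x ↦ (s (pair x)).1 0)
    ((continuous_apply 0).comp (continuous_subtype_val.comp (hs.comp hpair)))
  · exact absurd ((s (pair x)).2 (hx.trans (hcoord x 0).symm)) (by decide)
  · exact absurd ((s (pair x)).2 (hx.trans (hcoord x 1).symm)) (by decide)
end

section
/- For every integer k ≥ 1, the forgetful map f_2(S^{2k}) : PConf_3(S^{2k}) → PConf_2(S^{2k}) does not admit a continuous section, where S^{2k} is the unit sphere in (2k+1)-dimensional Euclidean space. -/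
/-- The unit `2k`-sphere in `ℝ^{2k+1}`. -/
abbrev EvenSphere (k : ℕ) : Type _ :=
  (Metric.sphere (0 : EuclideanSpace ℝ (Fin (2 * k + 1))) 1 : Set _)

section
open MeasureTheory Metric Polynomial
open scoped RealInnerProductSpace NNReal

theorem exists_polynomial_eval_eq_det {E : Type*} [NormedAddCommGroup E] [NormedSpace ℝ E]
    [FiniteDimensional ℝ E] (A : E →L[ℝ] E) :
    ∃ p : ℝ[X], p.natDegree ≤ Module.finrank ℝ E ∧ ∀ t, p.eval t = (1 + t • A).det := by
  let b := Module.finBasis ℝ E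
  let M := LinearMap.toMatrix b b (A : E →ₗ[ℝ] E)
  refine ⟨Matrix.det ((X : ℝ[X]) • M.map C + (1 : Matrix _ _ ℝ).map C), ?_, fun t ↦ ?_⟩
  · simpa using natDegree_det_X_add_C_le M 1
  · have : (1 + t • A).det = LinearMap.det (1 + t • (A : E →ₗ[ℝ] E)) := rfl
    rw [this, ← LinearMap.det_toMatrix b, ← coe_evalRingHom, RingHom.map_det]
    congr 1
    ext i j
    by_cases hij : i = j <;>
      simp [M, hij, LinearMap.toMatrix_one, mul_comm t, add_comm ((LinearMap.toMatrix b b) _ _ _ * t)]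

theorem det_one_add_smul_pos {E : Type*} [NormedAddCommGroup E] [NormedSpace ℝ E]
    [FiniteDimensional ℝ E] (A : E →L[ℝ] E) {t : ℝ} (ht : 0 ≤ t) (hA : t * ‖A‖ < 1) :
    0 < (1 + t • A).det := by
  have hne : ∀ s ∈ Set.Icc 0 t, (1 + s • A).det ≠ 0 := by
    intro s hs h0
    have hu : IsUnit (1 + s • A) := by
      have := isUnit_one_sub_of_norm_lt_one (x := -(s • A)) (by
        rw [norm_neg, norm_smul, Real.norm_of_nonneg hs.1]
        exact (mul_le_mul_of_nonneg_right hs.2 (norm_nonneg _)).trans_lt hA)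
      simpa using this
    obtain ⟨u, hu⟩ := hu
    have h1 : (1 + s • A).det * (↑u⁻¹ : E →L[ℝ] E).det = 1 := by
      rw [← hu]
      have : ((u : E →L[ℝ] E) * ↑u⁻¹).det = (1 : E →L[ℝ] E).det := by rw [Units.mul_inv]
      rw [show (1 : E →L[ℝ] E).det = 1 from LinearMap.det_id] at this
      rw [← this]
      exact (LinearMap.det_comp _ _).symm
    simp [h0] at h1
  have hc : Continuous fun s : ℝ ↦ (1 + s • A).det :=
    ContinuousLinearMap.continuous_det.comp (by fun_prop)
  have h1 : (1 + (0 : ℝ) • A).det = 1 := by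
    rw [zero_smul, add_zero]; exact LinearMap.det_id
  by_contra! hle
  obtain ⟨s, hs, hs0⟩ := intermediate_value_Icc' ht hc.continuousOn
    (show (0 : ℝ) ∈ _ from ⟨hle, by rw [h1]; exact zero_le_one⟩)
  exact hne s hs hs0

theorem not_sq_eq_one_add_X_sq_pow {n : ℕ} (hn : Odd n) (Q : ℝ[X]) :
    Q ^ 2 ≠ (1 + X ^ 2) ^ n := by
  intro h
  have h2 := congrArg (fun p : ℝ[X] ↦ (p.map (algebraMap ℝ ℂ)).rootMultiplicity Complex.I) h
  have hf : ((1 : ℂ[X]) + X ^ 2) = (X - C Complex.I) * (X - C (-Complex.I)) := by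
    have : (C Complex.I) * C Complex.I = (-1 : ℂ[X]) := by rw [← C_mul, Complex.I_mul_I]; simp
    rw [C_neg]
    linear_combination this
  have hr : ((1 : ℂ[X]) + X ^ 2).rootMultiplicity Complex.I = 1 := by
    have hI : Complex.I ≠ -Complex.I := by
      intro h; have := congrArg Complex.im h; norm_num at this
    rw [hf, rootMultiplicity_mul (mul_ne_zero (X_sub_C_ne_zero _) (X_sub_C_ne_zero _)),
      rootMultiplicity_X_sub_C_self, rootMultiplicity_X_sub_C, if_neg hI]
  simp [← count_roots, roots_pow, Polynomial.map_pow] at h2 hr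
  rw [hr] at h2
  obtain ⟨m, rfl⟩ := hn
  omega

variable {E : Type*} [NormedAddCommGroup E] [InnerProductSpace ℝ E] {V : E → E} {L : ℝ≥0}

theorem norm_add_smul_of_orthogonal (horth : ∀ x, ⟪x, V x⟫ = 0) (hnorm : ∀ x, ‖V x‖ = ‖x‖)
    (t : ℝ) (x : E) : ‖x + t • V x‖ = √(1 + t ^ 2) * ‖x‖ := by
  have h : ‖x + t • V x‖ ^ 2 = (√(1 + t ^ 2) * ‖x‖) ^ 2 := by
    rw [norm_add_sq_real, inner_smul_right, horth, norm_smul, hnorm, mul_pow, mul_pow,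
      Real.sq_sqrt (by positivity), Real.norm_eq_abs, sq_abs]
    ring
  exact (sq_eq_sq₀ (norm_nonneg _) (by positivity)).1 h

theorem bijective_add_smul [CompleteSpace E] (hL : LipschitzWith L V) {t : ℝ}
    (ht : 0 ≤ t) (htL : t * L < 1) : Function.Bijective fun x ↦ x + t • V x := by
  have happ : ApproximatesLinearOn (fun x ↦ x + t • V x)
      (ContinuousLinearEquiv.refl ℝ E : E →L[ℝ] E) Set.univ (t.toNNReal * L) := by
    intro x _ y _
    have : x + t • V x - (y + t • V y) - (x - y) = t • (V x - V y) := by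
      rw [smul_sub]; abel
    simp only [ContinuousLinearEquiv.coe_refl, ContinuousLinearMap.coe_id', id_eq, NNReal.coe_mul,
      Real.coe_toNNReal _ ht]
    rw [this, norm_smul, Real.norm_of_nonneg ht, mul_assoc]
    exact mul_le_mul_of_nonneg_left (by simpa [dist_eq_norm] using hL.dist_le_mul x y) ht
  have hc : Subsingleton E ∨ t.toNNReal * L <
      ‖((ContinuousLinearEquiv.refl ℝ E).symm : E →L[ℝ] E)‖₊⁻¹ := by
    rcases subsingleton_or_nontrivial E with h | h
    · exact .inl h
    · right
      have h1 : ‖((ContinuousLinearEquiv.refl ℝ E).symm : E →L[ℝ] E)‖₊ = 1 :=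
        NNReal.eq (ContinuousLinearMap.norm_id (𝕜 := ℝ) (E := E))
      rw [h1, inv_one, ← NNReal.coe_lt_coe]
      simpa [ht] using htL
  exact ⟨Set.injOn_univ.1 (happ.injOn hc), happ.surjective hc⟩

theorem image_add_smul_ball_diff [CompleteSpace E] (hL : LipschitzWith L V)
    (horth : ∀ x, ⟪x, V x⟫ = 0) (hnorm : ∀ x, ‖V x‖ = ‖x‖) {t : ℝ}
    (ht : 0 ≤ t) (htL : t * L < 1) :
    (fun x ↦ x + t • V x) '' (ball 0 1 \ {0}) = ball 0 √(1 + t ^ 2) \ {0} := by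
  have hpos : 0 < √(1 + t ^ 2) := by positivity
  have hmem : ∀ x, x + t • V x ∈ ball 0 √(1 + t ^ 2) \ {0} ↔ x ∈ ball 0 1 \ {0} := by
    intro x
    simp only [Set.mem_sdiff, mem_ball_zero_iff, Set.mem_singleton_iff]
    rw [← norm_eq_zero (a := x + t • V x), norm_add_smul_of_orthogonal horth hnorm]
    simp [hpos.ne', hpos]
  ext y
  constructor
  · rintro ⟨x, hx, rfl⟩
    exact (hmem x).2 hx
  · intro hy
    obtain ⟨x, rfl⟩ := (bijective_add_smul hL ht htL).2 y
    exact ⟨x, (hmem x).1 hy, rfl⟩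

/-- By the change of variables formula for `x ↦ x + t • V x`, which maps the unit ball onto the ball
of radius `√(1 + t ^ 2)`. -/
theorem integrableOn_and_integral_det [FiniteDimensional ℝ E] [MeasurableSpace E] [BorelSpace E]
    [Nontrivial E] (μ : Measure E) [μ.IsAddHaarMeasure] (hL : LipschitzWith L V)
    (horth : ∀ x, ⟪x, V x⟫ = 0) (hnorm : ∀ x, ‖V x‖ = ‖x‖)
    (hdiff : ∀ x ≠ 0, DifferentiableAt ℝ V x) {t : ℝ} (ht : 0 ≤ t) (htL : t * L < 1) :
    IntegrableOn (fun x ↦ (1 + t • fderiv ℝ V x).det) (ball 0 1 \ {0}) μ ∧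
      ∫ x in ball 0 1 \ {0}, (1 + t • fderiv ℝ V x).det ∂μ =
        √(1 + t ^ 2) ^ Module.finrank ℝ E * μ.real (ball 0 1) := by
  have hpos : ∀ x, 0 < (1 + t • fderiv ℝ V x).det := fun x ↦ det_one_add_smul_pos _ ht
    ((mul_le_mul_of_nonneg_left (norm_fderiv_le_of_lipschitz ℝ hL) ht).trans_lt htL)
  have hmeas : Measurable fun x ↦ (1 + t • fderiv ℝ V x).det :=
    ContinuousLinearMap.continuous_det.measurable.comp
      (((measurable_fderiv ℝ V).const_smul t).const_add 1)
  have hlint := lintegral_abs_det_fderiv_eq_addHaar_image μ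
    (s := ball (0 : E) 1 \ {0}) (f := fun x ↦ x + t • V x) (f' := fun x ↦ 1 + t • fderiv ℝ V x)
    (measurableSet_ball.diff (measurableSet_singleton 0))
    (fun x hx ↦ ((hasFDerivAt_id x).add
      ((hdiff x hx.2).hasFDerivAt.const_smul t)).hasFDerivWithinAt)
    (bijective_add_smul hL ht htL).1.injOn
  simp only [abs_of_pos (hpos _)] at hlint
  rw [image_add_smul_ball_diff hL horth hnorm ht htL,
    measure_sdiff_null (measure_singleton _), Measure.addHaar_ball μ 0 (Real.sqrt_nonneg _)] at hlint
  constructor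
  · refine ⟨hmeas.aestronglyMeasurable, ?_⟩
    rw [hasFiniteIntegral_iff_ofReal (.of_forall fun x ↦ (hpos x).le), hlint]
    exact ENNReal.mul_lt_top ENNReal.ofReal_lt_top measure_ball_lt_top
  · rw [integral_eq_lintegral_of_nonneg_ae (.of_forall fun x ↦ (hpos x).le)
      hmeas.aestronglyMeasurable, hlint, ENNReal.toReal_mul, ENNReal.toReal_ofReal (by positivity)]
    rfl

/-- The volume of the image of the unit ball under `x ↦ x + t • V x` is both a polynomial in `t` and
proportional to `√(1 + t ^ 2) ^ n`, which is impossible for odd `n`. -/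
theorem not_lipschitz_isometric_tangent_field [FiniteDimensional ℝ E]
    (hodd : Odd (Module.finrank ℝ E))
    (hL : LipschitzWith L V) (horth : ∀ x, ⟪x, V x⟫ = 0) (hnorm : ∀ x, ‖V x‖ = ‖x‖)
    (hdiff : ∀ x ≠ 0, DifferentiableAt ℝ V x) : False := by
  have : Nontrivial E := Module.nontrivial_of_finrank_pos (R := ℝ) hodd.pos
  borelize E
  let μ : Measure E := Measure.addHaar
  set n := Module.finrank ℝ E
  set ε : ℝ := 1 / (L + 1) with hε
  have hε0 : 0 < ε := by positivity
  have hεL : ∀ t ∈ Set.Icc 0 ε, t * L < 1 := fun t ht ↦ by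
    have h1 : t * L ≤ ε * L := mul_le_mul_of_nonneg_right ht.2 L.2
    have h2 : ε * L < 1 := by
      rw [hε, one_div_mul_eq_div, div_lt_one (by positivity)]; linarith
    exact h1.trans_lt h2
  obtain ⟨s, hs, hcard⟩ := (Set.Icc_infinite hε0).exists_subset_card_eq (n + 1)
  let r : ℝ → ℝ := fun t ↦ √(1 + t ^ 2) ^ n
  let Q := Lagrange.interpolate s id r
  have hball : μ.real (ball (0 : E) 1) ≠ 0 :=
    (ENNReal.toReal_pos (measure_ball_pos μ 0 one_pos).ne' measure_ball_lt_top.ne).ne'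
  have hQ : ∀ t ∈ Set.Icc 0 ε, Q.eval t = r t := by
    intro t ht
    have hpt : ∀ x, (1 + t • fderiv ℝ V x).det =
        ∑ i ∈ s, (1 + i • fderiv ℝ V x).det * (Lagrange.basis s id i).eval t := by
      intro x
      obtain ⟨p, hp, hpe⟩ := exists_polynomial_eval_eq_det (fderiv ℝ V x)
      have hdeg : p.degree < s.card := by
        rw [hcard]
        exact degree_le_natDegree.trans_lt (by exact_mod_cast Nat.lt_succ_of_le hp)
      have := congrArg (eval t) (Lagrange.eq_interpolate (v := id) Function.injective_id.injOn hdeg)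
      simpa [Lagrange.interpolate_apply, eval_finsetSum, hpe] using this
    have hint := (integrableOn_and_integral_det μ hL horth hnorm hdiff ht.1 (hεL t ht)).2
    simp_rw [hpt] at hint
    rw [integral_finsetSum _ fun i hi ↦ (integrableOn_and_integral_det μ hL horth hnorm hdiff (hs hi).1
      (hεL i (hs hi))).1.mul_const _] at hint
    simp_rw [integral_mul_const] at hint
    rw [Finset.sum_congr rfl fun i hi ↦ by
      rw [(integrableOn_and_integral_det μ hL horth hnorm hdiff (hs hi).1 (hεL i (hs hi))).2]] at hint
    refine mul_right_cancel₀ hball ?_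
    rw [← hint]
    simp only [Q, Lagrange.interpolate_apply, eval_finsetSum, eval_mul, eval_C, Finset.sum_mul, r]
    exact Finset.sum_congr rfl fun i _ ↦ by ring
  refine not_sq_eq_one_add_X_sq_pow hodd Q (eq_of_infinite_eval_eq _ _ ?_)
  refine (Set.Icc_infinite hε0).mono fun t ht ↦ ?_
  simp only [Set.mem_ofPred_eq, eval_pow, hQ t ht, r]
  rw [← pow_mul, mul_comm, pow_mul, Real.sq_sqrt (by positivity)]
  simp

theorem LipschitzOnWith.homogeneous_extension {w : E → E} (hw : LipschitzOnWith L w (sphere 0 1))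
    (hw1 : ∀ x ∈ sphere (0 : E) 1, ‖w x‖ = 1) :
    LipschitzWith (1 + 2 * L) fun x ↦ ‖x‖ • w (‖x‖⁻¹ • x) := by
  have hsph : ∀ x : E, x ≠ 0 → ‖x‖⁻¹ • x ∈ sphere (0 : E) 1 := fun x hx ↦ by
    simp [norm_smul, hx]
  refine LipschitzWith.of_dist_le_mul fun x y ↦ ?_
  wlog hyx : ‖y‖ ≤ ‖x‖ generalizing x y
  · rw [dist_comm, dist_comm x]
    exact this y x (le_of_not_ge hyx)
  simp only [dist_eq_norm, NNReal.coe_add, NNReal.coe_mul, NNReal.coe_one, NNReal.coe_ofNat]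
  have hL0 : (0 : ℝ) ≤ L := L.2
  rcases eq_or_ne y 0 with rfl | hy
  · rcases eq_or_ne x 0 with rfl | hx
    · simp
    · simp only [norm_zero, zero_smul, sub_zero, norm_smul, norm_norm, hw1 _ (hsph x hx)]
      nlinarith [norm_nonneg x]
  have hx : x ≠ 0 := norm_pos_iff.1 ((norm_pos_iff.2 hy).trans_le hyx)
  have hnx : ‖x‖ ≠ 0 := norm_ne_zero_iff.2 hx
  have hny : ‖y‖ ≠ 0 := norm_ne_zero_iff.2 hy
  have h0 : ‖x‖ - ‖y‖ ≤ ‖x - y‖ := norm_sub_norm_le x y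
  have h1 : ‖y‖ * ‖‖x‖⁻¹ • x - ‖y‖⁻¹ • y‖ ≤ 2 * ‖x - y‖ := by
    have : ‖y‖ • (‖x‖⁻¹ • x - ‖y‖⁻¹ • y) = (x - y) - ((‖x‖ - ‖y‖) * ‖x‖⁻¹) • x := by
      rw [smul_sub, smul_smul, smul_smul, mul_inv_cancel₀ hny, sub_mul, mul_inv_cancel₀ hnx]
      module
    rw [← norm_norm y, ← norm_smul, norm_norm y, this]
    refine (_root_.norm_sub_le _ _).trans ?_
    rw [norm_smul, norm_mul, norm_inv, norm_norm, mul_assoc, inv_mul_cancel₀ hnx, mul_one,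
      Real.norm_of_nonneg (sub_nonneg.2 hyx)]
    linarith
  have h2 : ‖w (‖x‖⁻¹ • x) - w (‖y‖⁻¹ • y)‖ ≤ L * ‖‖x‖⁻¹ • x - ‖y‖⁻¹ • y‖ := by
    simpa [dist_eq_norm] using hw.dist_le_mul _ (hsph x hx) _ (hsph y hy)
  calc ‖‖x‖ • w (‖x‖⁻¹ • x) - ‖y‖ • w (‖y‖⁻¹ • y)‖
      = ‖(‖x‖ - ‖y‖) • w (‖x‖⁻¹ • x) + ‖y‖ • (w (‖x‖⁻¹ • x) - w (‖y‖⁻¹ • y))‖ := by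
        congr 1; module
    _ ≤ (‖x‖ - ‖y‖) + ‖y‖ * ‖w (‖x‖⁻¹ • x) - w (‖y‖⁻¹ • y)‖ := by
        refine (norm_add_le _ _).trans_eq ?_
        rw [norm_smul, norm_smul, hw1 _ (hsph x hx), norm_norm, mul_one,
          Real.norm_of_nonneg (sub_nonneg.2 hyx)]
    _ ≤ (1 + 2 * L) * ‖x - y‖ := by
        nlinarith [mul_le_mul_of_nonneg_left h2 (norm_nonneg y), mul_le_mul_of_nonneg_left h1 hL0]

open scoped Manifold ContDiff in
theorem exists_contDiff_inner_pos [FiniteDimensional ℝ E] {u : sphere (0 : E) 1 → E}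
    (hu : Continuous u) (hu0 : ∀ x, u x ≠ 0) :
    ∃ p : E → E, ContDiff ℝ 1 p ∧ ∀ x : sphere (0 : E) 1, 0 < ⟪p x, u x⟫ := by
  let T : E → Set E := fun x ↦ {c | ∀ hx : x ∈ sphere (0 : E) 1, 0 < ⟪c, u ⟨x, hx⟩⟫}
  obtain ⟨p, hp⟩ := exists_contMDiffMap_forall_mem_convex_of_local_const (n := 1) 𝓘(ℝ, E) (t := T)
    (by
      intro x a ha b hb α β hα hβ hαβ hx
      rw [inner_add_left, inner_smul_left, inner_smul_left]
      have h1 := ha hx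
      have h2 := hb hx
      simp only [conj_trivial]
      rcases hα.eq_or_lt with rfl | hα
      · have : β = 1 := by linarith
        simp [this, h2]
      · have := mul_pos hα h1
        have := mul_nonneg hβ h2.le
        linarith)
    (by
      intro x
      by_cases hx : x ∈ sphere (0 : E) 1
      · refine ⟨u ⟨x, hx⟩, ?_⟩
        have hc : Continuous fun y ↦ ⟪u ⟨x, hx⟩, u y⟫ := by fun_prop
        have hev : ∀ᶠ y in nhds (⟨x, hx⟩ : sphere (0 : E) 1), 0 < ⟪u ⟨x, hx⟩, u y⟫ :=
          hc.continuousAt.eventually (lt_mem_nhds (real_inner_self_pos.2 (hu0 _)))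
        rw [nhds_subtype_eq_comap, Filter.eventually_comap] at hev
        filter_upwards [hev] with y hy hys using hy ⟨y, hys⟩ rfl
      · refine ⟨0, ?_⟩
        filter_upwards [isClosed_sphere.isOpen_compl.mem_nhds hx] with y hy hys using absurd hys hy)
  exact ⟨p, p.contMDiff.contDiff, fun x ↦ hp x x.2⟩

/-- The **hairy ball theorem**. -/
theorem hairy_ball [FiniteDimensional ℝ E] (hodd : Odd (Module.finrank ℝ E))
    {u : sphere (0 : E) 1 → E} (hu : Continuous u)
    (horth : ∀ x : sphere (0 : E) 1, ⟪(x : E), u x⟫ = 0) :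
    ∃ x, u x = 0 := by
  by_contra! hu0
  obtain ⟨p, hp, hpu⟩ := exists_contDiff_inner_pos hu hu0
  let q : E → E := fun x ↦ p x - ⟪x, p x⟫ • x
  have hq : ContDiff ℝ 1 q := hp.sub ((contDiff_id.inner ℝ hp).smul contDiff_id)
  have hq0 : ∀ x ∈ sphere (0 : E) 1, q x ≠ 0 := by
    intro x hx h0
    have h1 : ⟪q x, u ⟨x, hx⟩⟫ = ⟪p x, u ⟨x, hx⟩⟫ := by
      have := horth ⟨x, hx⟩
      simp only [q, inner_sub_left, inner_smul_left, this]
      simp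
    have := hpu ⟨x, hx⟩
    rw [← h1, h0, inner_zero_left] at this
    exact this.false
  let w : E → E := fun x ↦ ‖q x‖⁻¹ • q x
  have hw : ∀ x ∈ sphere (0 : E) 1, ContDiffAt ℝ 1 w x := fun x hx ↦
    ((hq.contDiffAt.norm ℝ (hq0 x hx)).inv (norm_ne_zero_iff.2 (hq0 x hx))).smul hq.contDiffAt
  have hw1 : ∀ x ∈ sphere (0 : E) 1, ‖w x‖ = 1 := fun x hx ↦ by
    simp [w, norm_smul, hq0 x hx]
  have hxw : ∀ x ∈ sphere (0 : E) 1, ⟪x, w x⟫ = 0 := fun x hx ↦ by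
    have hx1 : ‖x‖ = 1 := by simpa using hx
    simp [w, q, inner_smul_right, inner_sub_right, hx1]
  obtain ⟨L, hL⟩ := LocallyLipschitzOn.exists_lipschitzOnWith_of_compact (isCompact_sphere (0 : E) 1)
    (f := w) fun x hx ↦ by
      obtain ⟨K, t, ht, hK⟩ := (hw x hx).exists_lipschitzOnWith
      exact ⟨K, t, mem_nhdsWithin_of_mem_nhds ht, hK⟩
  have hsph : ∀ x : E, x ≠ 0 → ‖x‖⁻¹ • x ∈ sphere (0 : E) 1 := fun x hx ↦ by
    simp [norm_smul, hx]
  refine not_lipschitz_isometric_tangent_field hodd (hL.homogeneous_extension hw1) ?_ ?_ ?_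
  · intro x
    rcases eq_or_ne x 0 with rfl | hx
    · simp
    · have h := hxw _ (hsph x hx)
      rw [inner_smul_left] at h
      rw [inner_smul_right]
      simpa [hx] using h
  · intro x
    rcases eq_or_ne x 0 with rfl | hx
    · simp
    · rw [norm_smul, hw1 _ (hsph x hx), norm_norm, mul_one]
  · intro x hx
    have hn : DifferentiableAt ℝ (fun x : E ↦ ‖x‖) x := differentiableAt_id.norm ℝ hx
    refine hn.smul (DifferentiableAt.comp x (g := w) ?_ ?_)
    · exact (hw _ (hsph x hx)).differentiableAt one_ne_zero
    · exact (hn.inv (norm_ne_zero_iff.2 hx)).smul differentiableAt_id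
end

theorem no_section_even_sphere_two_points (k : ℕ) (hk : 1 ≤ k) :
    ¬ ∃ s : PConf 2 (EvenSphere k) → PConf 3 (EvenSphere k),
        Continuous s ∧ ∀ x, forgetPoint 2 (s x) = x := by
  rintro ⟨s, hs, hsec⟩
  have hinj : ∀ x : EvenSphere k, Function.Injective ![x, -x] := fun x ↦ by
    have hx : x ≠ -x := fun h ↦ by
      have h1 : (x : EuclideanSpace ℝ (Fin (2 * k + 1))) = -x := congrArg Subtype.val h
      have h2 := norm_eq_of_mem_sphere x
      have : IsAddTorsionFree (EuclideanSpace ℝ (Fin (2 * k + 1))) := .of_module_rat _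
      rw [self_eq_neg.1 h1, norm_zero] at h2
      exact zero_ne_one h2
    intro i j h
    fin_cases i <;> fin_cases j <;> simp_all [eq_comm]
  let c : EvenSphere k → PConf 2 (EvenSphere k) := fun x ↦ ⟨![x, -x], hinj x⟩
  have hc : Continuous c := Continuous.subtype_mk (by
    refine continuous_pi fun i ↦ ?_
    fin_cases i
    · exact continuous_id
    · exact continuous_neg) _
  let g : EvenSphere k → EvenSphere k := fun x ↦ (s (c x)).1 0
  have hg : Continuous g := (continuous_apply 0).comp (continuous_subtype_val.comp (hs.comp hc))
  have hval : ∀ x (i : Fin 2), (s (c x)).1 i.succ = ![x, -x] i := fun x i ↦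
    congrFun (congrArg Subtype.val (hsec (c x))) i
  have hgx : ∀ x, g x ≠ x := fun x h ↦
    Fin.succ_ne_zero (0 : Fin 2) ((s (c x)).2 ((hval x 0).trans h.symm))
  have hgnx : ∀ x, g x ≠ -x := fun x h ↦
    Fin.succ_ne_zero (1 : Fin 2) ((s (c x)).2 ((hval x 1).trans h.symm))
  obtain ⟨x, hx⟩ := hairy_ball (E := EuclideanSpace ℝ (Fin (2 * k + 1)))
    (by simp) (u := fun x ↦ (g x : EuclideanSpace ℝ (Fin (2 * k + 1))) -
      inner ℝ (x : EuclideanSpace ℝ (Fin (2 * k + 1))) (g x) • x)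
    (by fun_prop) (fun x ↦ by simp [inner_sub_right, inner_smul_right])
  have hx' := sub_eq_zero.1 hx
  set r := inner ℝ (x : EuclideanSpace ℝ (Fin (2 * k + 1))) (g x)
  have hr : |r| = 1 := by simpa [norm_smul] using (congrArg norm hx').symm
  rcases eq_or_eq_neg_of_abs_eq hr with h | h
  · exact hgx x (Subtype.ext (by simpa [h] using hx'))
  · exact hgnx x (Subtype.ext (by simpa [h] using hx'))
end

section
/- For every natural number n > 2 and every k ∈ {1,…,n}, there exists a continuous section of f_n(S²) : PConf_{n+1}(S²) → PConf_n(S²) whose image is contained in W_k(S²); in particular f_n(S²) admits a continuous section for all n > 2. -/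
section StereographicPerturbation

variable {E : Type*} [NormedAddCommGroup E] [InnerProductSpace ℝ E]

/-- Stereographic projection of `b` from the unit vector `a` to the hyperplane orthogonal to `a`. -/
noncomputable def stereoVec (a b : E) : E :=
  (1 - inner ℝ a b)⁻¹ • (b - (inner ℝ a b : ℝ) • a)

theorem inner_stereoVec {a : E} (ha : ‖a‖ = 1) (b : E) : inner ℝ a (stereoVec a b) = 0 := by
  simp [stereoVec, inner_smul_right, inner_sub_right, ha]

theorem one_sub_inner_pos {a b : E} (ha : ‖a‖ = 1) (hb : ‖b‖ = 1) (hab : a ≠ b) :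
    0 < 1 - (inner ℝ a b : ℝ) :=
  sub_pos.2 ((inner_lt_one_iff_real_of_norm_eq_one ha hb).2 hab)

theorem norm_stereoVec_sq {a b : E} (ha : ‖a‖ = 1) (hb : ‖b‖ = 1) (hab : a ≠ b) :
    ‖stereoVec a b‖ ^ 2 = (1 + inner ℝ a b) / (1 - inner ℝ a b) := by
  have h := one_sub_inner_pos ha hb hab
  have hsq : ‖b - (inner ℝ a b : ℝ) • a‖ ^ 2 = 1 - (inner ℝ a b : ℝ) ^ 2 := by
    rw [norm_sub_sq_real, inner_smul_right, norm_smul, ha, hb, real_inner_comm,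
      mul_one, Real.norm_eq_abs, sq_abs]
    ring
  rw [stereoVec, norm_smul, mul_pow, hsq, Real.norm_eq_abs, sq_abs]
  field_simp
  ring

theorem stereoVec_injective {a b c : E} (ha : ‖a‖ = 1) (hb : ‖b‖ = 1) (hc : ‖c‖ = 1)
    (hab : a ≠ b) (hac : a ≠ c) (h : stereoVec a b = stereoVec a c) : b = c := by
  have hb' := one_sub_inner_pos ha hb hab
  have hc' := one_sub_inner_pos ha hc hac
  have hinner : (inner ℝ a b : ℝ) = inner ℝ a c := by
    have hn := norm_stereoVec_sq ha hb hab
    rw [h, norm_stereoVec_sq ha hc hac, div_eq_div_iff hc'.ne' hb'.ne'] at hn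
    linarith
  rw [stereoVec, stereoVec, hinner] at h
  exact sub_left_injective (smul_right_injective E (inv_ne_zero hc'.ne') h)

/-- The point of the unit sphere obtained from `a` by moving in the tangent direction `w`. -/
noncomputable def spherePush (a w : E) : E :=
  (1 + ‖w‖ ^ 2)⁻¹ • ((1 - ‖w‖ ^ 2) • a + (2 : ℝ) • w)

theorem norm_spherePush {a w : E} (ha : ‖a‖ = 1) (haw : inner ℝ a w = 0) :
    ‖spherePush a w‖ = 1 := by
  have hq : 0 < 1 + ‖w‖ ^ 2 := by positivity
  have hsq : ‖(1 - ‖w‖ ^ 2) • a + (2 : ℝ) • w‖ ^ 2 = (1 + ‖w‖ ^ 2) ^ 2 := by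
    rw [norm_add_sq_real, inner_smul_left, inner_smul_right, haw, norm_smul, norm_smul, ha,
      mul_pow, mul_pow, Real.norm_eq_abs, Real.norm_eq_abs, sq_abs, sq_abs]
    ring
  have hn := (pow_left_inj₀ (norm_nonneg _) hq.le two_ne_zero).1 hsq
  rw [spherePush, norm_smul, hn, norm_inv, Real.norm_of_nonneg hq.le, inv_mul_cancel₀ hq.ne']

theorem norm_spherePush_sub_sq {a w : E} (ha : ‖a‖ = 1) (haw : inner ℝ a w = 0) :
    ‖spherePush a w - a‖ ^ 2 = 4 * ‖w‖ ^ 2 / (1 + ‖w‖ ^ 2) := by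
  have hq : 0 < 1 + ‖w‖ ^ 2 := by positivity
  have hinner : (inner ℝ (spherePush a w) a : ℝ) = (1 - ‖w‖ ^ 2) / (1 + ‖w‖ ^ 2) := by
    rw [spherePush, real_inner_comm, inner_smul_right, inner_add_right, inner_smul_right,
      inner_smul_right, haw, real_inner_self_eq_norm_sq, ha]
    field_simp
    ring
  rw [norm_sub_sq_real, norm_spherePush ha haw, ha, hinner]
  field_simp
  ring

theorem spherePush_ne {a w : E} (ha : ‖a‖ = 1) (haw : inner ℝ a w = 0) (hw : w ≠ 0) :
    spherePush a w ≠ a := by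
  intro h
  have hn := norm_spherePush_sub_sq ha haw
  have hw' : 0 < ‖w‖ := norm_pos_iff.2 hw
  have : 0 < 4 * ‖w‖ ^ 2 / (1 + ‖w‖ ^ 2) := by positivity
  rw [← hn, h, sub_self, norm_zero] at this
  norm_num at this

theorem norm_spherePush_sub_lt {a w : E} (ha : ‖a‖ = 1) (haw : inner ℝ a w = 0) (hw : w ≠ 0) :
    ‖spherePush a w - a‖ < 2 * ‖w‖ := by
  have hw' : 0 < ‖w‖ := norm_pos_iff.2 hw
  refine lt_of_pow_lt_pow_left₀ 2 (by positivity) ?_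
  rw [norm_spherePush_sub_sq ha haw, div_lt_iff₀ (by positivity)]
  nlinarith [pow_pos hw' 4]

/-- A point of the unit sphere near `a`, displaced from `a` by an amount governed by `r` in the
direction determined by two further points `b` and `c`. -/
noncomputable def nearbyPoint (a b c : E) (r : ℝ) : E :=
  spherePush a ((r / ‖stereoVec a b - stereoVec a c‖) • (stereoVec a b - stereoVec a c))

theorem nearbyPoint_spec {a b c : E} {r : ℝ} (ha : ‖a‖ = 1) (hb : ‖b‖ = 1) (hc : ‖c‖ = 1)
    (hab : a ≠ b) (hac : a ≠ c) (hbc : b ≠ c) (hr : 0 < r) :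
    ‖nearbyPoint a b c r‖ = 1 ∧ nearbyPoint a b c r ≠ a ∧
      ‖nearbyPoint a b c r - a‖ < 2 * r := by
  have hv : stereoVec a b - stereoVec a c ≠ 0 := fun h =>
    hbc (stereoVec_injective ha hb hc hab hac (sub_eq_zero.1 h))
  have hv' := norm_pos_iff.2 hv
  have hw := smul_ne_zero (div_pos hr hv').ne' hv
  have haw : inner ℝ a ((r / ‖stereoVec a b - stereoVec a c‖) •
      (stereoVec a b - stereoVec a c)) = 0 := by
    simp [inner_smul_right, inner_sub_right, inner_stereoVec ha]
  refine ⟨norm_spherePush ha haw, spherePush_ne ha haw hw, ?_⟩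
  have h := norm_spherePush_sub_lt ha haw hw
  rwa [norm_smul, Real.norm_of_nonneg (div_pos hr hv').le, div_mul_cancel₀ _ hv'.ne'] at h

theorem Continuous.nearbyPoint {X : Type*} [TopologicalSpace X] {a b c : X → E} {r : X → ℝ}
    (ha : Continuous a) (hb : Continuous b) (hc : Continuous c) (hr : Continuous r)
    (ha1 : ∀ x, ‖a x‖ = 1) (hb1 : ∀ x, ‖b x‖ = 1) (hc1 : ∀ x, ‖c x‖ = 1)
    (hab : ∀ x, a x ≠ b x) (hac : ∀ x, a x ≠ c x) (hbc : ∀ x, b x ≠ c x) :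
    Continuous fun x => nearbyPoint (a x) (b x) (c x) (r x) := by
  have hstereo : ∀ {d : X → E}, Continuous d → (∀ x, ‖d x‖ = 1) → (∀ x, a x ≠ d x) →
      Continuous fun x => stereoVec (a x) (d x) := fun {d} hd hd1 had =>
    ((continuous_const.sub (ha.inner hd)).inv₀ fun x =>
      (one_sub_inner_pos (ha1 x) (hd1 x) (had x)).ne').smul (hd.sub ((ha.inner hd).smul ha))
  have hv := (hstereo hb hb1 hab).sub (hstereo hc hc1 hac)
  have hw := (hr.div hv.norm fun x => norm_ne_zero_iff.2 fun h => hbc x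
    (stereoVec_injective (ha1 x) (hb1 x) (hc1 x) (hab x) (hac x) (sub_eq_zero.1 h))).smul hv
  have hq := hw.norm.pow 2
  exact ((continuous_const.add hq).inv₀ fun x =>
    (add_pos_of_pos_of_nonneg one_pos (sq_nonneg _)).ne').smul
    (((continuous_const.sub hq).smul ha).add (continuous_const.smul hw))

end StereographicPerturbation

theorem continuous_pconf_apply {n : ℕ} {S : Type*} [TopologicalSpace S] (l : Fin n) :
    Continuous fun x : PConf n S => x.1 l :=
  (continuous_apply l).comp continuous_subtype_val

/-- The pairwise distances of a configuration admit a positive lower bound depending continuously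
on the configuration. -/
theorem exists_continuous_separation {n : ℕ} (hn : 2 < n) (S : Type*) [MetricSpace S] :
    ∃ δ : PConf n S → ℝ, Continuous δ ∧ (∀ x, 0 < δ x) ∧
      ∀ x i j, i ≠ j → δ x ≤ dist (x.1 i) (x.1 j) := by
  have hne : (Finset.univ : Finset (Fin n)).offDiag.Nonempty :=
    ⟨(⟨0, by omega⟩, ⟨1, by omega⟩), by simp⟩
  refine ⟨fun x => Finset.univ.offDiag.inf' hne fun p => dist (x.1 p.1) (x.1 p.2),
    Continuous.finset_inf'_apply hne fun p _ =>
      (continuous_pconf_apply p.1).dist (continuous_pconf_apply p.2), fun x => ?_, fun x i j hij => ?_⟩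
  · rw [Finset.lt_inf'_iff]
    intro p hp
    exact dist_pos.2 (x.2.ne (by simpa using hp))
  · exact Finset.inf'_le (fun p : Fin n × Fin n => dist (x.1 p.1) (x.1 p.2))
      (show (i, j) ∈ Finset.univ.offDiag by simpa using hij)

theorem section_near_xk_exists_S2 (n : ℕ) (hn : 2 < n) (k : Fin (n + 1)) (hk : k ≠ 0) :
    ∃ s : PConf n Sphere2 → PConf (n + 1) Sphere2,
      Continuous s ∧ (∀ x, forgetPoint n (s x) = x) ∧ ∀ x, Wnear n k (s x) := by
  obtain ⟨k, rfl⟩ := Fin.exists_succ_eq.2 hk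
  obtain ⟨i, j, hki, hkj, hij⟩ : ∃ i j : Fin n, k ≠ i ∧ k ≠ j ∧ i ≠ j := by
    obtain ⟨i, hi⟩ := Finset.exists_mem_notMem_of_card_lt_card
      (s := {k}) (t := Finset.univ) (by simp; omega)
    obtain ⟨j, hj⟩ := Finset.exists_mem_notMem_of_card_lt_card
      (s := {k, i}) (t := Finset.univ) (Finset.card_le_two.trans_lt (by simpa using hn))
    simp only [Finset.mem_univ, Finset.mem_singleton, Finset.mem_insert, not_or, true_and] at hi hj
    exact ⟨i, j, Ne.symm hi, Ne.symm hj.1, Ne.symm hj.2⟩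
  obtain ⟨δ, hδ, hδ_pos, hδ_le⟩ := exists_continuous_separation hn Sphere2
  have hnorm : ∀ (x : PConf n Sphere2) l, ‖(x.1 l : EuclideanSpace ℝ (Fin 3))‖ = 1 :=
    fun x l => norm_eq_of_mem_sphere _
  have hne : ∀ (x : PConf n Sphere2) {l m}, l ≠ m →
      (x.1 l : EuclideanSpace ℝ (Fin 3)) ≠ x.1 m :=
    fun x _ _ h => Subtype.coe_injective.ne (x.2.ne h)
  have hcoord : ∀ l, Continuous fun x : PConf n Sphere2 =>
      (x.1 l : EuclideanSpace ℝ (Fin 3)) := fun l =>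
    continuous_subtype_val.comp (continuous_pconf_apply l)
  have hspec := fun x : PConf n Sphere2 => nearbyPoint_spec (hnorm x k) (hnorm x i) (hnorm x j)
    (hne x hki) (hne x hkj) (hne x hij) (div_pos (hδ_pos x) four_pos)
  let p : PConf n Sphere2 → Sphere2 := fun x =>
    ⟨nearbyPoint (x.1 k : EuclideanSpace ℝ (Fin 3)) (x.1 i) (x.1 j) (δ x / 4),
      mem_sphere_zero_iff_norm.2 (hspec x).1⟩
  have hp : Continuous p := (Continuous.nearbyPoint (hcoord k) (hcoord i) (hcoord j)
    (hδ.div_const 4) (hnorm · k) (hnorm · i) (hnorm · j) (hne · hki) (hne · hkj)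
    (hne · hij)).subtype_mk _
  have hdist : ∀ x, dist (p x) (x.1 k) < δ x / 2 := fun x => by
    have h := (hspec x).2.2
    rw [Subtype.dist_eq, dist_eq_norm]
    change ‖nearbyPoint _ _ _ _ - _‖ < _
    linarith
  have hp_ne : ∀ x l, x.1 l ≠ p x := by
    intro x l h
    by_cases hl : l = k
    · subst hl
      exact (hspec x).2.1 (congrArg Subtype.val h).symm
    · have h1 := hdist x
      rw [← h] at h1
      linarith [hδ_le x l k hl, hδ_pos x]
  refine ⟨fun x => ⟨Fin.cons (p x) x.1, Fin.cons_injective_iff.2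
    ⟨fun ⟨l, hl⟩ => hp_ne x l hl, x.2⟩⟩, ?_, fun x => ?_, fun x l m hl hm hlm => ?_⟩
  · refine Continuous.subtype_mk (continuous_pi fun l => ?_) _
    refine Fin.cases ?_ (fun l => ?_) l
    · simpa using hp
    · simp only [Fin.cons_succ]
      exact continuous_pconf_apply l
  · ext l : 2
    simp [forgetPoint]
  · obtain ⟨l, rfl⟩ := Fin.exists_succ_eq.2 hl
    obtain ⟨m, rfl⟩ := Fin.exists_succ_eq.2 hm
    simp only [Fin.cons_zero, Fin.cons_succ]
    linarith [hdist x, hδ_le x l m fun h => hlm (congrArg Fin.succ h)]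
end

section
/- Let n be a natural number with n = 2, n = 3, or n > 4. Then the map F_n(S²) : PConf_{n+1}(S²)/Σ_n → Conf_n(S²) between unordered configuration spaces does not admit a continuous section. -/
/-- Extension of a permutation of `{1,…,n}` to a permutation of `{0,1,…,n}` fixing `0`. -/
def extendPerm (n : ℕ) (σ : Equiv.Perm (Fin n)) : Equiv.Perm (Fin (n + 1)) where
  toFun := Fin.cases 0 (fun j => (σ j).succ)
  invFun := Fin.cases 0 (fun j => (σ.symm j).succ)
  left_inv i := by induction i using Fin.cases <;> simp
  right_inv i := by induction i using Fin.cases <;> simp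

/-- The orbit setoid of the permutation action `(σ • x) i = x (σ⁻¹ i)` on `PConf n S`. -/
def confSetoid (n : ℕ) (S : Type*) : Setoid (PConf n S) where
  r x y := ∃ σ : Equiv.Perm (Fin n), x.1 = y.1 ∘ σ
  iseqv := by
    constructor
    · exact fun x => ⟨Equiv.refl _, rfl⟩
    · rintro x y ⟨σ, h⟩
      refine ⟨σ.symm, funext fun i => ?_⟩
      simp [h]
    · rintro x y z ⟨σ, h⟩ ⟨τ, h'⟩
      refine ⟨σ.trans τ, funext fun i => ?_⟩
      simp [h, h']

/-- The orbit setoid on `PConf (n+1) S` for the action of `Perm (Fin n)` permuting the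
coordinates `1,…,n` and fixing the 0th coordinate. -/
def uconfSetoid (n : ℕ) (S : Type*) : Setoid (PConf (n + 1) S) where
  r x y := ∃ σ : Equiv.Perm (Fin n), x.1 = y.1 ∘ (extendPerm n σ)
  iseqv := by
    constructor
    · refine fun x => ⟨Equiv.refl _, funext fun i => ?_⟩
      induction i using Fin.cases <;> simp [extendPerm]
    · rintro x y ⟨σ, h⟩
      refine ⟨σ.symm, funext fun i => ?_⟩
      rw [h]
      induction i using Fin.cases <;> simp [extendPerm]
    · rintro x y z ⟨σ, h⟩ ⟨τ, h'⟩
      refine ⟨σ.trans τ, funext fun i => ?_⟩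
      rw [h, h']
      induction i using Fin.cases <;> simp [extendPerm]

/-- The unordered configuration space `Conf_n(S)`. -/
abbrev Conf (n : ℕ) (S : Type*) : Type _ := Quotient (confSetoid n S)

/-- The quotient of `PConf_{n+1}(S)` by the action of `Σ_n` on the coordinates `1,…,n`. -/
abbrev UConf (n : ℕ) (S : Type*) : Type _ := Quotient (uconfSetoid n S)

/-- The map `F_n(S)` induced by `f_n(S)` on the quotients. -/
def forgetQ (n : ℕ) (S : Type*) : UConf n S → Conf n S :=
  Quotient.map (forgetPoint n) (by
    rintro x y ⟨σ, h⟩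
    refine ⟨σ, funext fun i => ?_⟩
    have hi := congrFun h i.succ
    simpa [forgetPoint, extendPerm] using hi)

open Metric Module

/-- Continuous maps from a sphere of dimension at least two lift along surjective covering maps. -/
theorem IsCoveringMap.exists_continuous_lift_sphere {E Y B : Type*} [NormedAddCommGroup E]
    [InnerProductSpace ℝ E] (hE : 2 < finrank ℝ E) [TopologicalSpace Y] [TopologicalSpace B]
    {p : Y → B} (hp : IsCoveringMap p) (hsurj : Function.Surjective p)
    {f : sphere (0 : E) 1 → B} (hf : Continuous f) :
    ∃ F : sphere (0 : E) 1 → Y, Continuous F ∧ ∀ x, p (F x) = f x := by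
  have local_lift (v x₀ : sphere (0 : E) 1) (hx₀ : x₀ ≠ v) (y : Y) (hy : p y = f x₀) :
      ∃ F : sphere (0 : E) 1 → Y, ContinuousOn F {v}ᶜ ∧ F x₀ = y ∧ ∀ x ≠ v, p (F x) = f x := by
    have hv := norm_eq_of_mem_sphere v
    let e := stereographic hv
    have hsymm : Continuous e.symm := (isOpenEmbedding_stereographic_symm hv).continuous
    have hleft {x : sphere (0 : E) 1} (hx : x ≠ v) : e.symm (e x) = x := e.left_inv hx
    obtain ⟨F, ⟨hF₀, hF⟩, -⟩ := hp.existsUnique_continuousMap_lifts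
      ⟨fun w ↦ f (e.symm w), hf.comp hsymm⟩ (e x₀) y (by simp [hleft hx₀, hy])
    refine ⟨F ∘ e, F.continuous.comp_continuousOn e.continuousOn, hF₀, fun x hx ↦ ?_⟩
    simpa [hleft hx] using congrFun hF (e x)
  have : FiniteDimensional ℝ E := .of_finrank_pos (by lia)
  have : Nontrivial E := nontrivial_of_finrank_pos (R := ℝ) (by lia)
  obtain ⟨v⟩ : Nonempty (sphere (0 : E) 1) := (NormedSpace.sphere_nonempty.2 zero_le_one).to_subtype
  have hvv : v ≠ -v := ne_neg_of_mem_unit_sphere ℝ v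
  have hconn : IsConnected ({v, -v}ᶜ : Set (sphere (0 : E) 1)) := by
    have hv := norm_eq_of_mem_sphere v
    let e := stereographic hv
    have hsymm : Continuous e.symm := (isOpenEmbedding_stereographic_symm hv).continuous
    have hrank : 1 < Module.rank ℝ (ℝ ∙ (v : E))ᗮ := by
      rw [← finrank_eq_rank]
      have h₁ := (ℝ ∙ (v : E)).finrank_add_finrank_orthogonal
      rw [finrank_span_singleton (by simpa using ne_zero_of_mem_unit_sphere v)] at h₁
      exact_mod_cast (by lia : 1 < finrank ℝ (ℝ ∙ (v : E))ᗮ)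
    convert (isConnected_compl_singleton_of_one_lt_rank hrank 0).image e.symm
      hsymm.continuousOn using 1
    have he0 : e (-v) = 0 := stereographic_apply_neg v
    ext x
    simp only [Set.mem_compl_iff, Set.mem_insert_iff, Set.mem_singleton_iff, not_or, Set.mem_image]
    constructor
    · rintro ⟨hx, hx'⟩
      refine ⟨e x, fun h0 ↦ hx' ?_, e.left_inv hx⟩
      exact e.injOn hx hvv.symm (h0.trans he0.symm)
    · rintro ⟨w, hw, rfl⟩
      refine ⟨e.map_target (Set.mem_univ w), fun h ↦ hw ?_⟩
      rw [← he0, ← h, e.right_inv (Set.mem_univ w)]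
  obtain ⟨x₀, hx₀⟩ := hconn.nonempty
  simp only [Set.mem_compl_iff, Set.mem_insert_iff, Set.mem_singleton_iff, not_or] at hx₀
  obtain ⟨y, hy⟩ := hsurj (f x₀)
  obtain ⟨F, hFc, hF₀, hF⟩ := local_lift v x₀ hx₀.1 y hy
  obtain ⟨G, hGc, hG₀, hG⟩ := local_lift (-v) x₀ hx₀.2 y hy
  have hFG : Set.EqOn F G {v, -v}ᶜ := by
    refine hp.eqOn_of_comp_eqOn hconn.isPreconnected (hFc.mono (by simp)) (hGc.mono (by simp))
      (fun x hx ↦ ?_) (by simpa using hx₀) (hF₀.trans hG₀.symm)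
    simp only [Set.mem_compl_iff, Set.mem_insert_iff, Set.mem_singleton_iff, not_or] at hx
    simp [hF x hx.1, hG x hx.2]
  classical
  refine ⟨Function.update F v (G v), continuous_iff_continuousAt.2 fun x ↦ ?_, fun x ↦ ?_⟩
  · by_cases hx : x = v
    · subst hx
      refine (hGc.continuousAt (isOpen_compl_singleton.mem_nhds hvv)).congr ?_
      filter_upwards [isOpen_compl_singleton.mem_nhds hvv] with z hz
      by_cases hzx : z = x
      · simp [hzx]
      · rw [Function.update_of_ne hzx, hFG (by simpa [hzx] using hz)]
    · exact (continuousAt_update_of_ne hx).2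
        (hFc.continuousAt (isOpen_compl_singleton.mem_nhds hx))
  · by_cases hx : x = v
    · simp [hx, hG v hvv]
    · simp [hx, hF x hx]

/-- The group of unit quaternions. -/
abbrev UnitQuaternion : Type := sphere (0 : Quaternion ℝ) 1

namespace UnitQuaternion

noncomputable instance : Group UnitQuaternion := Metric.unitSphere.instGroup

noncomputable instance : Monoid UnitQuaternion := inferInstance

instance : PreconnectedSpace UnitQuaternion :=
  Subtype.preconnectedSpace <| isPreconnected_sphere
    (by rw [← finrank_eq_rank, Quaternion.finrank_eq_four]; norm_num) _ _

/-- A nowhere vanishing continuous function on the unit quaternions has a continuous argument. -/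
theorem exists_continuous_arg {φ : UnitQuaternion → ℂ} (hφ : Continuous φ) (h0 : ∀ q, φ q ≠ 0) :
    ∃ θ : UnitQuaternion → ℝ, Continuous θ ∧
      ∀ q, φ q = ‖φ q‖ * Complex.exp (θ q * Complex.I) := by
  have hn (q : UnitQuaternion) : ‖φ q‖ ≠ 0 := norm_ne_zero_iff.2 (h0 q)
  obtain ⟨θ, hθ, h⟩ := Circle.isCoveringMap_exp.exists_continuous_lift_sphere
    (E := Quaternion ℝ) (by simp [Quaternion.finrank_eq_four]) Circle.exp_surjective
    (f := fun q ↦ ⟨φ q / ‖φ q‖, mem_sphere_zero_iff_norm.2 (by simp [hn q])⟩)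
    (Continuous.subtype_mk (by fun_prop (disch := simpa using h0)) _)
  refine ⟨θ, hθ, fun q ↦ ?_⟩
  have hq : ((‖φ q‖ : ℝ) : ℂ) ≠ 0 := Complex.ofReal_ne_zero.2 (hn q)
  rw [← Circle.coe_exp, h q]
  exact (mul_div_cancel₀ _ hq).symm

/-- A continuous real function whose image in the circle is constant is itself constant. -/
theorem eq_of_exp_eq {δ : UnitQuaternion → ℝ} (hδ : Continuous δ) {c : ℂ}
    (hc : ∀ q, Complex.exp (δ q * Complex.I) = c) (q r : UnitQuaternion) : δ q = δ r :=
  Circle.isCoveringMap_exp.const_of_comp hδ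
    (fun a b ↦ Circle.ext (by simp [Circle.coe_exp, hc])) q r

/-- A nowhere vanishing function on the unit quaternions cannot be rotated nontrivially by
translation along an element of finite order. -/
theorem eq_one_of_map_mul_eq {φ : UnitQuaternion → ℂ} (hφ : Continuous φ) (h0 : ∀ q, φ q ≠ 0)
    {u : UnitQuaternion} (hu : IsOfFinOrder u) {ζ : ℂ} (hζ : ‖ζ‖ = 1)
    (hφu : ∀ q, φ (q * u) = ζ * φ q) : ζ = 1 := by
  obtain ⟨θ, hθ, h⟩ := exists_continuous_arg hφ h0
  have hn (q : UnitQuaternion) : (‖φ q‖ : ℂ) ≠ 0 := by simpa using h0 q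
  have hexp (q : UnitQuaternion) : Complex.exp (((θ (q * u) - θ q : ℝ) : ℂ) * Complex.I) = ζ := by
    have h₁ := hφu q
    rw [h (q * u), h q, hφu q, norm_mul, hζ, one_mul] at h₁
    rw [Complex.ofReal_sub, sub_mul, Complex.exp_sub, div_eq_iff (Complex.exp_ne_zero _)]
    apply mul_left_cancel₀ (hn q)
    linear_combination h₁
  have hconst := eq_of_exp_eq (δ := fun q ↦ θ (q * u) - θ q) (by fun_prop) hexp
  have hpow (k : ℕ) : θ (u ^ k) = θ 1 + k * (θ (1 * u) - θ 1) := by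
    induction k with
    | zero => simp
    | succ k ih =>
      have := hconst (u ^ k) 1
      rw [pow_succ]
      push_cast
      linarith
  obtain ⟨k, hk, huk⟩ := isOfFinOrder_iff_pow_eq_one.1 hu
  have h₁ := hpow k
  rw [huk] at h₁
  have h₂ : θ (1 * u) - θ 1 = 0 := by
    have : (k : ℝ) ≠ 0 := by exact_mod_cast hk.ne'
    simpa [this] using h₁
  rw [← hexp 1, h₂]
  simp

end UnitQuaternion

namespace Sphere2

/-- The first coordinate, i.e. the height along the polar axis. -/
def height (x : Sphere2) : ℝ := x.1 0

/-- The last two coordinates, as a complex number. -/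
def planar (x : Sphere2) : ℂ := ⟨x.1 1, x.1 2⟩

@[fun_prop]
theorem continuous_height : Continuous height := by
  unfold height; fun_prop

@[fun_prop]
theorem continuous_planar : Continuous planar := by
  have : planar = fun x ↦ Complex.equivRealProdCLM.symm (x.1 1, x.1 2) := rfl
  rw [this]
  fun_prop

theorem height_sq_add_normSq (x : Sphere2) : height x ^ 2 + Complex.normSq (planar x) = 1 := by
  have h := x.2
  rw [mem_sphere_zero_iff_norm, EuclideanSpace.norm_eq, Real.sqrt_eq_one, Fin.sum_univ_three] at h
  simp only [Real.norm_eq_abs, sq_abs] at h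
  rw [Complex.normSq_apply]
  simp only [height, planar]
  linarith

@[ext]
theorem ext_height_planar {x y : Sphere2} (h : height x = height y) (h' : planar x = planar y) :
    x = y := by
  obtain ⟨h₁, h₂⟩ := Complex.ext_iff.1 h'
  ext i
  fin_cases i
  exacts [h, h₁, h₂]

/-- The point of the sphere with given height and planar part. -/
def mk (t : ℝ) (w : ℂ) (h : t ^ 2 + Complex.normSq w = 1) : Sphere2 :=
  ⟨!₂[t, w.re, w.im], by
    rw [mem_sphere_zero_iff_norm, EuclideanSpace.norm_eq, Real.sqrt_eq_one, Fin.sum_univ_three]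
    simpa [Complex.normSq_apply, ← sq, ← add_assoc] using h⟩

@[simp]
theorem height_mk (t : ℝ) (w : ℂ) (h) : height (mk t w h) = t := rfl

@[simp]
theorem planar_mk (t : ℝ) (w : ℂ) (h) : planar (mk t w h) = w := rfl

/-- The purely imaginary quaternion corresponding to a point of the sphere. -/
def toQuaternion (x : Sphere2) : Quaternion ℝ := ⟨0, x.height, x.planar.re, x.planar.im⟩

@[simp]
theorem re_toQuaternion (x : Sphere2) : (toQuaternion x).re = 0 := rfl

@[simp]
theorem imI_toQuaternion (x : Sphere2) : (toQuaternion x).imI = x.height := rfl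

@[simp]
theorem imJ_toQuaternion (x : Sphere2) : (toQuaternion x).imJ = x.planar.re := rfl

@[simp]
theorem imK_toQuaternion (x : Sphere2) : (toQuaternion x).imK = x.planar.im := rfl

theorem normSq_toQuaternion (x : Sphere2) : Quaternion.normSq (toQuaternion x) = 1 := by
  have h := height_sq_add_normSq x
  rw [Complex.normSq_apply] at h
  simp only [Quaternion.normSq_def', re_toQuaternion, imI_toQuaternion, imJ_toQuaternion,
    imK_toQuaternion]
  linarith

theorem toQuaternion_injective : Function.Injective toQuaternion := fun _ _ h ↦
  ext_height_planar (congrArg (·.imI) h)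
    (Complex.ext (congrArg (·.imJ) h) (congrArg (·.imK) h))

theorem isInducing_toQuaternion : Topology.IsInducing toQuaternion := by
  refine .of_comp (g := fun y ↦ !₂[y.imI, y.imJ, y.imK]) ?_ ?_ ?_
  · have : toQuaternion = fun x ↦ Quaternion.linearIsometryEquivTuple.symm
        !₂[0, x.height, x.planar.re, x.planar.im] := by
      funext x
      rw [LinearIsometryEquiv.eq_symm_apply]
      rfl
    rw [this]
    fun_prop
  · have hI := Quaternion.continuous_imI
    have hJ := Quaternion.continuous_imJ
    have hK := Quaternion.continuous_imK
    fun_prop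
  · convert! Topology.IsInducing.subtypeVal
    ext x i
    fin_cases i <;> rfl

/-- The point of the sphere corresponding to a purely imaginary unit quaternion. -/
def ofQuaternion (y : Quaternion ℝ) (h : Quaternion.normSq y = 1) (h0 : y.re = 0) : Sphere2 :=
  mk y.imI ⟨y.imJ, y.imK⟩ (by
    rw [Quaternion.normSq_def', h0] at h
    rw [Complex.normSq_apply]
    linarith)

theorem toQuaternion_ofQuaternion (y : Quaternion ℝ) (h) (h0 : y.re = 0) :
    toQuaternion (ofQuaternion y h h0) = y := by
  ext
  exacts [h0.symm, rfl, rfl, rfl]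

end Sphere2

namespace UnitQuaternion

theorem normSq_coe (q : UnitQuaternion) : Quaternion.normSq (q : Quaternion ℝ) = 1 := by
  rw [Quaternion.normSq_eq_norm_mul_self, norm_eq_of_mem_sphere, one_mul]

theorem coe_inv_eq_star (q : UnitQuaternion) :
    ((q⁻¹ : UnitQuaternion) : Quaternion ℝ) = star (q : Quaternion ℝ) := by
  rw [Metric.unitSphere.coe_inv, Quaternion.inv_def, normSq_coe, inv_one, one_smul]

open Sphere2 in
/-- The unit quaternions act on the sphere by conjugation. -/
noncomputable instance : MulAction UnitQuaternion Sphere2 where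
  smul q x := ofQuaternion (q * toQuaternion x * star (q : Quaternion ℝ))
    (by simp [normSq_toQuaternion, normSq_coe])
    (by simp; ring)
  one_smul x := toQuaternion_injective <| by
    change toQuaternion (ofQuaternion _ _ _) = _
    rw [toQuaternion_ofQuaternion]; simp
  mul_smul q r x := toQuaternion_injective <| by
    change toQuaternion (ofQuaternion _ _ _) = toQuaternion (ofQuaternion _ _ _)
    simp only [toQuaternion_ofQuaternion]
    change _ = _ * toQuaternion (ofQuaternion _ _ _) * _
    simp only [toQuaternion_ofQuaternion]
    simp [mul_assoc]

theorem toQuaternion_smul (q : UnitQuaternion) (x : Sphere2) :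
    Sphere2.toQuaternion (q • x) = q * Sphere2.toQuaternion x * star (q : Quaternion ℝ) :=
  Sphere2.toQuaternion_ofQuaternion _ _ _

instance : ContinuousSMul UnitQuaternion Sphere2 where
  continuous_smul := by
    rw [Sphere2.isInducing_toQuaternion.continuous_iff]
    have := Sphere2.isInducing_toQuaternion.continuous
    simp only [Function.comp_def, toQuaternion_smul]
    fun_prop

/-- The unit quaternion given by a unit complex number. -/
noncomputable def ofCircle : Circle →* UnitQuaternion where
  toFun z := ⟨Quaternion.ofComplex z, by
    rw [mem_sphere_zero_iff_norm, ← sq_eq_sq₀ (norm_nonneg _) zero_le_one, sq,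
      ← Quaternion.normSq_eq_norm_mul_self, Quaternion.normSq_def']
    have := Circle.normSq_coe z
    rw [Complex.normSq_apply] at this
    simp
    linarith⟩
  map_one' := Subtype.ext (by simp)
  map_mul' _ _ := Subtype.ext (by simp)

@[simp]
theorem coe_ofCircle (z : Circle) :
    (ofCircle z : Quaternion ℝ) = Quaternion.coeComplex (z : ℂ) := rfl

/-- The quaternion unit `j`. -/
noncomputable def unitJ : UnitQuaternion :=
  ⟨Quaternion.linearIsometryEquivTuple.symm !₂[0, 0, 1, 0], by
    rw [mem_sphere_zero_iff_norm, LinearIsometryEquiv.norm_map]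
    simp [EuclideanSpace.norm_eq, Fin.sum_univ_four]⟩

@[simp]
theorem re_unitJ : (unitJ : Quaternion ℝ).re = 0 := rfl

@[simp]
theorem imI_unitJ : (unitJ : Quaternion ℝ).imI = 0 := rfl

@[simp]
theorem imJ_unitJ : (unitJ : Quaternion ℝ).imJ = 1 := rfl

@[simp]
theorem imK_unitJ : (unitJ : Quaternion ℝ).imK = 0 := rfl

theorem height_smul (q : UnitQuaternion) (x : Sphere2) :
    (q • x).height = (q * x.toQuaternion * star (q : Quaternion ℝ)).imI :=
  congrArg (·.imI) (toQuaternion_smul q x)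

theorem planar_smul (q : UnitQuaternion) (x : Sphere2) :
    (q • x).planar = ⟨(q * x.toQuaternion * star (q : Quaternion ℝ)).imJ,
      (q * x.toQuaternion * star (q : Quaternion ℝ)).imK⟩ :=
  Complex.ext (congrArg (·.imJ) (toQuaternion_smul q x))
    (congrArg (·.imK) (toQuaternion_smul q x))

@[simp]
theorem height_ofCircle_smul (z : Circle) (x : Sphere2) : (ofCircle z • x).height = x.height := by
  have h := Circle.normSq_coe z
  rw [Complex.normSq_apply] at h
  rw [height_smul]
  simp
  linear_combination x.height * h

@[simp]
theorem planar_ofCircle_smul (z : Circle) (x : Sphere2) :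
    (ofCircle z • x).planar = z ^ 2 * x.planar := by
  rw [planar_smul]
  apply Complex.ext <;> simp [sq] <;> ring

@[simp]
theorem height_unitJ_smul (x : Sphere2) : (unitJ • x).height = -x.height := by
  rw [height_smul]
  simp

@[simp]
theorem planar_unitJ_smul (x : Sphere2) : (unitJ • x).planar = starRingEnd ℂ x.planar := by
  rw [planar_smul]
  apply Complex.ext <;> simp

theorem unitJ_mul_ofCircle (z : Circle) : unitJ * ofCircle z = (ofCircle z)⁻¹ * unitJ := by
  apply Subtype.ext
  rw [Metric.unitSphere.coe_mul, Metric.unitSphere.coe_mul, coe_inv_eq_star]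
  ext <;> simp

end UnitQuaternion

/-- A continuous section of `F_n(S)` yields a continuous symmetric choice of a point off each
configuration. -/
theorem exists_new_point_of_section {n : ℕ} {S : Type*} [TopologicalSpace S]
    {t : Conf n S → UConf n S} (ht : Continuous t) (hsec : ∀ x, forgetQ n S (t x) = x) :
    ∃ g : PConf n S → S, Continuous g ∧ (∀ x i, g x ≠ x.1 i) ∧
      ∀ x y, (∃ σ : Equiv.Perm (Fin n), x.1 = y.1 ∘ σ) → g x = g y := by
  let ev : UConf n S → S := Quotient.lift (fun y ↦ y.1 0) <| by
    rintro x y ⟨σ, h⟩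
    simpa [extendPerm] using congrFun h 0
  have hev : Continuous ev :=
    ((continuous_apply 0).comp continuous_subtype_val).quotient_lift _
  refine ⟨fun x ↦ ev (t ⟦x⟧), hev.comp (ht.comp continuous_quotient_mk'), fun x i ↦ ?_,
    fun x y h ↦ congrArg (fun c ↦ ev (t c)) (Quotient.sound h)⟩
  have hx := hsec ⟦x⟧
  obtain ⟨y, hy⟩ := Quotient.exists_rep (t ⟦x⟧)
  change ev (t ⟦x⟧) ≠ _
  rw [← hy] at hx ⊢
  obtain ⟨σ, h⟩ := Quotient.exact hx.symm
  rw [h]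
  exact fun h0 ↦ Fin.succ_ne_zero _ (y.2 h0).symm

open UnitQuaternion in
/-- A continuous section of `F_n(S²)`, pulled back along the orbit of a configuration `c` under
rotations, is equivariant under the symmetries of `c`. -/
theorem exists_equivariant_map_of_section {n : ℕ} {t : Conf n Sphere2 → UConf n Sphere2}
    (ht : Continuous t) (hsec : ∀ x, forgetQ n Sphere2 (t x) = x)
    {c : Fin n → Sphere2} (hc : Function.Injective c) :
    ∃ h : UnitQuaternion → Sphere2, Continuous h ∧ (∀ q i, h q ≠ c i) ∧
      ∀ u : UnitQuaternion, (∀ i, ∃ j, u • c i = c j) → ∀ q, u • h (q * u) = h q := by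
  obtain ⟨g, hg, hne, hsymm⟩ := exists_new_point_of_section ht hsec
  let orbit (q : UnitQuaternion) : PConf n Sphere2 :=
    ⟨fun i ↦ q • c i, (MulAction.injective q).comp hc⟩
  have horbit : Continuous orbit := by
    refine Continuous.subtype_mk ?_ _
    fun_prop
  refine ⟨fun q ↦ q⁻¹ • g (orbit q), by fun_prop, fun q i hq ↦ hne (orbit q) i ?_,
    fun u hu q ↦ ?_⟩
  · rw [inv_smul_eq_iff] at hq
    exact hq
  · choose σ hσ using hu
    have hσinj : Function.Injective σ := fun i j hij ↦
      hc (MulAction.injective u (by simp [hσ, hij]))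
    have hgu : g (orbit (q * u)) = g (orbit q) := by
      refine hsymm _ _ ⟨.ofBijective σ (Finite.injective_iff_bijective.1 hσinj), ?_⟩
      funext i
      simp [orbit, mul_smul, hσ]
    simp only [hgu]
    rw [mul_inv_rev, mul_smul, smul_inv_smul]

open UnitQuaternion Sphere2 in
/-- A map from the unit quaternions to the sphere which is equivariant under a nontrivial rotation
of finite order meets the axis of that rotation. -/
theorem exists_planar_eq_zero {h : UnitQuaternion → Sphere2} (hh : Continuous h) {z : Circle}
    (hz : IsOfFinOrder z) (hz2 : (z : ℂ) ^ 2 ≠ 1)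
    (hu : ∀ q, ofCircle z • h (q * ofCircle z) = h q) : ∃ q, (h q).planar = 0 := by
  by_contra! h0
  refine hz2 (inv_eq_one.1 (eq_one_of_map_mul_eq (φ := fun q ↦ (h q).planar) (by fun_prop) h0
    (ofCircle.isOfFinOrder hz) (by simp [Circle.norm_coe]) fun q ↦ ?_))
  rw [← hu q, planar_ofCircle_smul, inv_mul_cancel_left₀ (by simp)]

open Sphere2 in
theorem eq_mk_of_planar_eq_zero {x : Sphere2} (hx : x.planar = 0) :
    x = mk 1 0 (by simp) ∨ x = mk (-1) 0 (by simp) := by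
  have h := height_sq_add_normSq x
  rw [hx, map_zero, add_zero, sq_eq_one_iff] at h
  exact h.imp (fun h ↦ ext_height_planar h hx) (fun h ↦ ext_height_planar h hx)

open UnitQuaternion Sphere2 in
/-- The map `F_{m+2}(S²)` has no continuous section when the configuration of the two poles and the
`m`-th roots of unity on the equator has a nontrivial rotational symmetry `z²`. -/
theorem not_exists_section_of_pow_eq_one {m : ℕ} {z : Circle} (hz : IsOfFinOrder z)
    (hz2 : (z : ℂ) ^ 2 ≠ 1) (hpow : 0 < m → ((z : ℂ) ^ 2) ^ m = 1)
    (hinj : ∀ i < m, ∀ j < m, ((z : ℂ) ^ 2) ^ i = ((z : ℂ) ^ 2) ^ j → i = j) :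
    ¬ ∃ t : Conf (m + 2) Sphere2 → UConf (m + 2) Sphere2,
        Continuous t ∧ ∀ x, forgetQ (m + 2) Sphere2 (t x) = x := by
  rintro ⟨t, ht, hsec⟩
  let equator (j : Fin m) : Sphere2 := mk 0 (((z : ℂ) ^ 2) ^ (j : ℕ)) (by simp)
  let c : Fin (m + 2) → Sphere2 :=
    Fin.cons (mk 1 0 (by simp)) (Fin.cons (mk (-1) 0 (by simp)) equator)
  have hc : Function.Injective c := by
    refine Fin.cons_injective_iff.2 ⟨?_, Fin.cons_injective_iff.2 ⟨?_, fun i j hij ↦ ?_⟩⟩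
    · rintro ⟨i, hi⟩
      have h₁ := congrArg height hi
      induction i using Fin.cases <;> norm_num [equator] at h₁
    · rintro ⟨i, hi⟩
      have h₁ := congrArg height hi
      norm_num [equator] at h₁
    · exact Fin.ext (hinj i i.2 j j.2 (congrArg planar hij))
  obtain ⟨h, hh, hne, heq⟩ := exists_equivariant_map_of_section ht hsec hc
  have hstable : ∀ i, ∃ j, ofCircle z • c i = c j := by
    refine Fin.cases ⟨0, ?_⟩ (Fin.cases ⟨1, ?_⟩ fun j ↦ ?_)
    · exact ext_height_planar (by simp [c]) (by simp [c])
    · exact ext_height_planar (by simp [c]) (by simp [c])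
    · have hj : ofCircle z • c j.succ.succ = mk 0 (((z : ℂ) ^ 2) ^ (j + 1 : ℕ)) (by simp) :=
        ext_height_planar (by simp [c, equator]) (by simp [c, equator, pow_succ'])
      by_cases hjm : (j : ℕ) + 1 < m
      · exact ⟨Fin.succ (Fin.succ ⟨j + 1, hjm⟩), hj⟩
      · refine ⟨Fin.succ (Fin.succ ⟨0, j.pos⟩), hj.trans (ext_height_planar rfl ?_)⟩
        have hjm' : (j : ℕ) + 1 = m := by lia
        change ((z : ℂ) ^ 2) ^ (j + 1 : ℕ) = ((z : ℂ) ^ 2) ^ 0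
        rw [hjm', hpow j.pos, pow_zero]
  obtain ⟨q, hq⟩ := exists_planar_eq_zero hh hz hz2 (heq _ hstable)
  rcases eq_mk_of_planar_eq_zero hq with hq | hq
  · exact hne q 0 hq
  · exact hne q 1 hq

open Sphere2 in
theorem re_planar_mul_conj_lt_one {x : Sphere2} {ζ : ℂ} (h : 0 ^ 2 + Complex.normSq ζ = 1)
    (hx : x ≠ mk 0 ζ h) : (x.planar * starRingEnd ℂ ζ).re < 1 := by
  by_contra! hle
  have h₁ := height_sq_add_normSq x
  have h₂ := Complex.normSq_sub x.planar ζ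
  have h₃ := Complex.normSq_nonneg (x.planar - ζ)
  have h₄ := sq_nonneg x.height
  refine hx (ext_height_planar (sq_eq_zero_iff.1 ?_) (sub_eq_zero.1 (Complex.normSq_eq_zero.1 ?_)))
  · linarith
  · rw [planar_mk]
    linarith

namespace Sphere2

/-- A complex function on the sphere which, for `ω` a primitive cube root of unity, has no zeros
other than the points `1, ω, ω²` of the equator. -/
noncomputable def phase (ω : ℂ) (x : Sphere2) : ℂ :=
  (1 + x.height) + ω ^ 2 * (1 - x.height) - starRingEnd ℂ x.planar - ω ^ 2 * x.planar

theorem continuous_phase (ω : ℂ) : Continuous (phase ω) := by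
  have := Complex.continuous_conj
  unfold phase
  fun_prop

variable {ω : ℂ} {x y z : Sphere2}

theorem phase_add_phase_add_phase (hω : ω ^ 2 + ω + 1 = 0) (hconj : starRingEnd ℂ ω = ω ^ 2)
    (hy : y.height = x.height) (hy' : y.planar = ω * x.planar)
    (hz : z.height = x.height) (hz' : z.planar = ω ^ 2 * x.planar) :
    phase ω x + phase ω y + phase ω z = 3 * ((1 + x.height) + ω ^ 2 * (1 - x.height)) := by
  simp only [phase, hy, hy', hz, hz', map_mul, map_pow, hconj]
  grind

open scoped ComplexOrder in
theorem phase_mul_phase_mul_phase_pos (hω : ω ^ 2 + ω + 1 = 0) (hconj : starRingEnd ℂ ω = ω ^ 2)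
    (hx : ∀ (j : Fin 3) h, x ≠ mk 0 (ω ^ (j : ℕ)) h)
    (hy : y.height = x.height) (hy' : y.planar = ω * x.planar)
    (hz : z.height = x.height) (hz' : z.planar = ω ^ 2 * x.planar) :
    0 < phase ω x * phase ω y * phase ω z := by
  have hnorm : Complex.normSq ω = 1 := by
    have h : (Complex.normSq ω : ℂ) = 1 := by
      rw [← Complex.mul_conj, hconj]
      linear_combination (ω - 1) * hω
    exact_mod_cast h
  have hpos (j : Fin 3) : (0 : ℂ) < ↑(2 - 2 * (x.planar * starRingEnd ℂ (ω ^ (j : ℕ))).re) := by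
    have := re_planar_mul_conj_lt_one (by simp [hnorm]) (hx j (by simp [hnorm]))
    exact_mod_cast (by linarith : (0 : ℝ) < _)
  have h : (x.height : ℂ) ^ 2 + x.planar * starRingEnd ℂ x.planar = 1 := by
    rw [Complex.mul_conj]
    exact_mod_cast height_sq_add_normSq x
  convert mul_pos (mul_pos (hpos 0) (hpos 1)) (hpos 2) using 1
  simp only [Complex.ofReal_sub, Complex.ofReal_mul, Complex.ofReal_ofNat,
    Complex.re_eq_add_conj, map_mul, map_pow, hconj,
    phase, hy, hy', hz, hz']
  simp only [Fin.val_zero, Fin.val_one, Fin.val_two]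
  grind

theorem phase_unitJ_smul (hω : ω ^ 2 + ω + 1 = 0) (hconj : starRingEnd ℂ ω = ω ^ 2)
    (hy : y.height = x.height) (hy' : y.planar = ω * x.planar) :
    phase ω (UnitQuaternion.unitJ • x) = ω ^ 2 * starRingEnd ℂ (phase ω y) := by
  simp only [phase, hy, hy', UnitQuaternion.height_unitJ_smul, UnitQuaternion.planar_unitJ_smul,
    map_mul, map_pow, map_add, map_sub, map_one, hconj, Complex.conj_conj, Complex.conj_ofReal,
    Complex.ofReal_neg]
  grind

end Sphere2

/-- A linear combination of three real numbers whose coefficients are the cube roots of unity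
vanishes only if the three numbers agree. -/
theorem eq_of_add_mul_add_sq_mul_eq_zero {ω : ℂ} (hω : ω ^ 2 + ω + 1 = 0) (him : ω.im ≠ 0)
    {a b c : ℝ} (h : (a : ℂ) + ω * b + ω ^ 2 * c = 0) : a = c ∧ b = c := by
  have h' : ((a - c : ℝ) : ℂ) + ω * ((b - c : ℝ) : ℂ) = 0 := by
    push_cast
    linear_combination h - c * hω
  have hb : b = c := by simpa [him, sub_eq_zero] using congrArg Complex.im h'
  subst hb
  exact ⟨by simpa [sub_eq_zero] using congrArg Complex.re h', rfl⟩

open UnitQuaternion in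
open scoped ComplexOrder in
/-- A function on the unit quaternions which is twisted-equivariant under a dihedral group of
order `6` generated by `u` and `τ` takes values of argument `ω` along some `⟨u⟩`-orbit. -/
theorem exists_eq_norm_mul_of_dihedral {φ : UnitQuaternion → ℂ} (hφ : Continuous φ) {ω : ℂ}
    (hω : ω ^ 2 + ω + 1 = 0) (him : ω.im ≠ 0) {u τ : UnitQuaternion} (hu3 : u ^ 3 = 1)
    (hτ : τ * u = u⁻¹ * τ) (hφpos : ∀ q, 0 < φ q * φ (q * u) * φ (q * u * u))
    (hφτ : ∀ q, φ (q * τ) = ω ^ 2 * starRingEnd ℂ (φ (q * u))) :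
    ∃ q, φ q = ‖φ q‖ * ω ∧ φ (q * u) = ‖φ (q * u)‖ * ω ∧
      φ (q * u * u) = ‖φ (q * u * u)‖ * ω := by
  have hω3 : ω ^ 3 = 1 := by linear_combination (ω - 1) * hω
  have hωnorm : ‖ω‖ = 1 := Complex.norm_eq_one_of_pow_eq_one hω3 (by norm_num)
  have hφ0 (q) : φ q ≠ 0 := left_ne_zero_of_mul (left_ne_zero_of_mul (hφpos q).ne')
  have hn (q) : (‖φ q‖ : ℂ) ≠ 0 := by simpa using hφ0 q
  obtain ⟨θ, hθ, hφE⟩ := exists_continuous_arg (φ := φ) hφ hφ0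
  have hexpS (q) : Complex.exp ((θ q + θ (q * u) + θ (q * u * u) : ℝ) * Complex.I) = 1 := by
    have h₁ := Complex.eq_coe_norm_of_nonneg (hφpos q).le
    push_cast [norm_mul] at h₁
    rw [hφE q, hφE (q * u), hφE (q * u * u)] at h₁
    simp only [Complex.ofReal_add, add_mul, Complex.exp_add]
    apply mul_left_cancel₀ (mul_ne_zero (mul_ne_zero (hn q) (hn (q * u))) (hn (q * u * u)))
    simp only [norm_mul, Complex.norm_exp_ofReal_mul_I, Complex.norm_real, norm_norm,
      mul_one] at h₁
    linear_combination h₁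
  have hexpκ (q) : Complex.exp ((θ (q * τ) + θ (q * u) : ℝ) * Complex.I) = ω ^ 2 := by
    have h₁ : φ (q * τ) * φ (q * u) = ω ^ 2 * (‖φ (q * u)‖ * ‖φ (q * u)‖) := by
      rw [hφτ, mul_assoc, mul_comm (starRingEnd ℂ _), Complex.mul_conj, Complex.normSq_eq_norm_sq,
        Complex.ofReal_pow, sq (‖φ (q * u)‖ : ℂ)]
    have h₂ : ‖φ (q * τ)‖ = ‖φ (q * u)‖ := by simp [hφτ, hωnorm]
    have h₃ := hφE (q * τ)
    rw [h₂] at h₃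
    rw [h₃] at h₁
    nth_rw 2 [hφE (q * u)] at h₁
    simp only [Complex.ofReal_add, add_mul, Complex.exp_add]
    apply mul_left_cancel₀ (mul_ne_zero (hn (q * u)) (hn (q * u)))
    linear_combination h₁
  have hθu : Continuous fun q ↦ θ (q * u) := hθ.comp (continuous_mul_const u)
  have hθuu : Continuous fun q ↦ θ (q * u * u) := hθu.comp (continuous_mul_const u)
  have hθτ : Continuous fun q ↦ θ (q * τ) := hθ.comp (continuous_mul_const τ)
  have hS := eq_of_exp_eq (δ := fun q ↦ θ q + θ (q * u) + θ (q * u * u))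
    ((hθ.add hθu).add hθuu) hexpS
  have hκ := eq_of_exp_eq (δ := fun q ↦ θ (q * τ) + θ (q * u)) (hθτ.add hθu) hexpκ
  have huuu (q : UnitQuaternion) : q * u * u * u = q := by
    rw [mul_assoc, mul_assoc, ← pow_three, hu3, mul_one]
  have hju (q : UnitQuaternion) : q * τ * u = q * u * u * τ := by
    rw [mul_assoc, hτ, ← mul_assoc, ← huuu (q * u⁻¹),
      inv_mul_cancel_right]
  obtain ⟨q, hq⟩ : ∃ q, (θ q : ℂ) + ω * θ (q * u) + ω ^ 2 * θ (q * u * u) = 0 := by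
    by_contra! h0
    have h₁ : ω ^ 2 = 1 := by
      refine eq_one_of_map_mul_eq (u := u)
        (φ := fun q ↦ (θ q : ℂ) + ω * θ (q * u) + ω ^ 2 * θ (q * u * u))
        (((Complex.continuous_ofReal.comp hθ).add
          (continuous_const.mul (Complex.continuous_ofReal.comp hθu))).add
          (continuous_const.mul (Complex.continuous_ofReal.comp hθuu))) h0
        (isOfFinOrder_iff_pow_eq_one.2 ⟨3, by norm_num, hu3⟩) (by simp [hωnorm]) fun q ↦ ?_
      simp only [huuu]
      linear_combination -(θ (q * u) + ω * θ (q * u * u)) * hω3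
    have h₂ : ω = -2 := by linear_combination hω - h₁
    norm_num [h₂] at h₁
  obtain ⟨h₁, h₂⟩ := eq_of_add_mul_add_sq_mul_eq_zero hω him hq
  have hκq : θ (q * τ) + θ (q * u) = 2 * θ (q * u * u) := by
    have e₁ := hκ (q * u * u) q
    have e₂ := hκ (q * u) q
    have e₃ := hS (q * τ) q
    rw [hju, hju, huuu] at e₃
    rw [huuu] at e₁
    linarith
  have hE : Complex.exp (θ (q * u * u) * Complex.I) = ω := by
    have e₁ := hexpS q
    have e₂ := hexpκ q
    rw [hκq] at e₂
    rw [h₁, h₂] at e₁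
    simp only [two_mul, Complex.ofReal_add, add_mul, Complex.exp_add] at e₁ e₂
    rw [e₂] at e₁
    linear_combination ω * e₁ - Complex.exp (θ (q * u * u) * Complex.I) * hω3
  exact ⟨q, by rw [← hE, ← h₁]; exact hφE q, by rw [← hE, ← h₂]; exact hφE (q * u),
    by rw [← hE]; exact hφE (q * u * u)⟩

open UnitQuaternion Sphere2 in
open scoped ComplexOrder in
/-- The map `F_3(S²)` has no continuous section. -/
theorem not_exists_section_three :
    ¬ ∃ t : Conf 3 Sphere2 → UConf 3 Sphere2,
        Continuous t ∧ ∀ x, forgetQ 3 Sphere2 (t x) = x := by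
  rintro ⟨t, ht, hsec⟩
  obtain ⟨z, hprim⟩ : ∃ z : Circle, IsPrimitiveRoot (z : ℂ) 3 := by
    refine ⟨Circle.exp (2 * Real.pi / 3), ?_⟩
    convert Complex.isPrimitiveRoot_exp 3 (by norm_num) using 1
    rw [Circle.coe_exp]
    push_cast
    ring_nf
  set ω := (z : ℂ) with hωdef
  have hω : ω ^ 2 + ω + 1 = 0 := by
    have := hprim.geom_sum_eq_zero (by norm_num)
    simp only [Finset.sum_range_succ, Finset.sum_range_zero] at this
    linear_combination this
  have hω3 : ω ^ 3 = 1 := hprim.pow_eq_one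
  have hconj : starRingEnd ℂ ω = ω ^ 2 := by
    rw [hωdef, ← Circle.coe_inv_eq_conj, Circle.coe_inv, ← hωdef, inv_eq_iff_eq_inv]
    exact eq_inv_of_mul_eq_one_left (by linear_combination hω3)
  have him : ω.im ≠ 0 := fun h ↦ by
    have := congrArg Complex.re hω
    simp [sq, h] at this
    nlinarith [sq_nonneg (ω.re + 1 / 2)]
  have hz3 : z ^ 3 = 1 := Circle.ext (by simpa using hω3)
  let c (j : Fin 3) : Sphere2 := mk 0 (ω ^ (j : ℕ)) (by simp [hωdef])
  have hc : Function.Injective c := fun i j hij ↦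
    Fin.ext (hprim.pow_inj i.2 j.2 (congrArg planar hij))
  obtain ⟨h, hh, hne, heq⟩ := exists_equivariant_map_of_section ht hsec hc
  set u := ofCircle z with hu
  have hu3 : u ^ 3 = 1 := by rw [hu, ← map_pow, hz3, map_one]
  have hqu (q) : u • h (q * u) = h q := by
    refine heq u (fun i ↦ ?_) q
    fin_cases i
    · exact ⟨2, ext_height_planar (by simp [hu, c]) (by simp [hu, c, hωdef])⟩
    · exact ⟨0, ext_height_planar (by simp [hu, c])
        (by simpa [hu, c, ← hωdef, ← pow_succ] using hω3)⟩
    · refine ⟨1, ext_height_planar (by simp [hu, c]) ?_⟩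
      simp [hu, c, ← hωdef]
      linear_combination ω * hω3
  have hqj (q) : unitJ • h (q * unitJ) = h q := by
    refine heq unitJ (fun i ↦ ?_) q
    fin_cases i
    · exact ⟨0, ext_height_planar (by simp [c]) (by simp [c])⟩
    · exact ⟨2, ext_height_planar (by simp [c]) (by simp [c, hconj])⟩
    · refine ⟨1, ext_height_planar (by simp [c]) ?_⟩
      simp [c, hconj]
      linear_combination ω * hω3
  have hqj' (q) : h (q * unitJ) = unitJ • h q := by
    apply ext_height_planar <;> rw [← hqj q] <;> simp
  have hheight (q) : (h (q * u)).height = (h q).height := by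
    rw [← hqu q, hu, height_ofCircle_smul]
  have hplanar (q) : (h (q * u)).planar = ω * (h q).planar := by
    rw [← hqu q, hu, planar_ofCircle_smul]
    linear_combination -(h (q * ofCircle z)).planar * hω3
  have hheight' (q) : (h (q * u * u)).height = (h q).height := by rw [hheight, hheight]
  have hplanar' (q) : (h (q * u * u)).planar = ω ^ 2 * (h q).planar := by
    rw [hplanar, hplanar]; ring
  let φ (q : UnitQuaternion) : ℂ := phase ω (h q)
  have hφpos (q) : 0 < φ q * φ (q * u) * φ (q * u * u) :=
    phase_mul_phase_mul_phase_pos hω hconj (fun j _ ↦ hne q j) (hheight q) (hplanar q)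
      (hheight' q) (hplanar' q)
  have hφ0 (q) : φ q ≠ 0 := left_ne_zero_of_mul (left_ne_zero_of_mul (hφpos q).ne')
  have hφj (q) : φ (q * unitJ) = ω ^ 2 * starRingEnd ℂ (φ (q * u)) := by
    simp only [φ, hqj']
    exact phase_unitJ_smul hω hconj (hheight q) (hplanar q)
  obtain ⟨q, e₀, e₁, e₂⟩ := exists_eq_norm_mul_of_dihedral (φ := φ) ((continuous_phase ω).comp hh)
    hω him hu3 (unitJ_mul_ofCircle z) hφpos hφj
  have hsum := phase_add_phase_add_phase hω hconj (hheight q) (hplanar q) (hheight' q) (hplanar' q)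
  have hsum' : ((‖φ q‖ + ‖φ (q * u)‖ + ‖φ (q * u * u)‖ + 3 * (1 - (h q).height) : ℝ) : ℂ) * ω =
      ((6 * (h q).height : ℝ) : ℂ) := by
    push_cast
    linear_combination hsum - e₀ - e₁ - e₂ + 3 * (1 - ((h q).height : ℂ)) * hω
  have hR := congrArg Complex.im hsum'
  rw [Complex.im_ofReal_mul, Complex.ofReal_im] at hR
  have hheight_le : (h q).height ≤ 1 := by
    nlinarith [height_sq_add_normSq (h q), Complex.normSq_nonneg (h q).planar]
  have h₃ := norm_pos_iff.2 (hφ0 q)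
  have h₄ := norm_nonneg (φ (q * u))
  have h₅ := norm_nonneg (φ (q * u * u))
  exact (mul_ne_zero (by linarith) him) hR

theorem no_section_unordered_S2 (n : ℕ) (hn : n = 2 ∨ n = 3 ∨ 4 < n) :
    ¬ ∃ t : Conf n Sphere2 → UConf n Sphere2,
        Continuous t ∧ ∀ x, forgetQ n Sphere2 (t x) = x := by
  rcases hn with rfl | rfl | hn
  · have hI : ((Circle.exp (Real.pi / 2) : Circle) : ℂ) = Complex.I := by
      simp [Circle.coe_exp, Complex.exp_pi_div_two_mul_I]
    refine not_exists_section_of_pow_eq_one (m := 0) (z := Circle.exp (Real.pi / 2))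
      (isOfFinOrder_iff_pow_eq_one.2 ⟨4, by norm_num, Circle.ext ?_⟩) ?_ (by simp) (by simp)
    · simp only [Circle.coe_pow, hI, Complex.I_pow_four, Circle.coe_one]
    · rw [hI, Complex.I_sq]
      norm_num
  · exact not_exists_section_three
  · obtain ⟨m, rfl⟩ := Nat.exists_eq_add_of_le' (show 2 ≤ n by lia)
    have hm : m ≠ 0 := by lia
    have hprim := Complex.isPrimitiveRoot_exp m hm
    have hz : ((Circle.exp (Real.pi / m) : Circle) : ℂ) ^ 2 =
        Complex.exp (2 * Real.pi * Complex.I / m) := by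
      rw [Circle.coe_exp, ← Complex.exp_nat_mul]
      push_cast
      ring_nf
    refine not_exists_section_of_pow_eq_one (z := Circle.exp (Real.pi / m))
      (isOfFinOrder_iff_pow_eq_one.2 ⟨2 * m, by lia, Circle.ext ?_⟩) ?_ ?_ ?_
    · rw [Circle.coe_pow, pow_mul, hz, hprim.pow_eq_one, Circle.coe_one]
    · rw [hz]
      exact hprim.ne_one (by lia)
    · rw [hz]
      exact fun _ ↦ hprim.pow_eq_one
    · rw [hz]
      exact fun i hi j hj ↦ hprim.pow_inj hi hj
end

section
/- For every natural number n ≥ 1, the map F_n(ℝ²) : PConf_{n+1}(ℝ²)/Σ_n → Conf_n(ℝ²) between unordered configuration spaces admits a continuous section. -/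
/-- Adjoin to a configuration in `E` the multiple of a unit vector `e` by one plus the sum of the
norms of its points. -/
noncomputable def adjoinFarPoint (n : ℕ) {E : Type*} [NormedAddCommGroup E] [NormedSpace ℝ E]
    (e : E) (he : ‖e‖ = 1) (x : PConf n E) : PConf (n + 1) E :=
  ⟨Fin.cons ((1 + ∑ i, ‖x.1 i‖) • e) x.1, by
    refine Fin.cons_injective_iff.2 ⟨?_, x.2⟩
    rintro ⟨j, hj⟩
    have hnonneg : 0 ≤ ∑ i, ‖x.1 i‖ := Finset.sum_nonneg fun i _ => norm_nonneg _
    have hle : ‖x.1 j‖ ≤ ∑ i, ‖x.1 i‖ :=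
      Finset.single_le_sum (f := fun i => ‖x.1 i‖) (fun i _ => norm_nonneg _) (Finset.mem_univ j)
    rw [hj, norm_smul, he, Real.norm_of_nonneg (by linarith)] at hle
    linarith⟩

theorem continuous_adjoinFarPoint (n : ℕ) {E : Type*} [NormedAddCommGroup E] [NormedSpace ℝ E]
    (e : E) (he : ‖e‖ = 1) : Continuous (adjoinFarPoint n e he) := by
  have hcoord (j : Fin n) : Continuous fun x : PConf n E => x.1 j :=
    (continuous_apply j).comp continuous_subtype_val
  refine Continuous.subtype_mk (continuous_pi fun i => ?_) _
  induction i using Fin.cases with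
  | zero =>
    exact (continuous_const.add (continuous_finsetSum _ fun j _ => (hcoord j).norm)).smul
      continuous_const
  | succ j => exact hcoord j

theorem adjoinFarPoint_rel (n : ℕ) {E : Type*} [NormedAddCommGroup E] [NormedSpace ℝ E]
    (e : E) (he : ‖e‖ = 1) {x y : PConf n E} (h : confSetoid n E x y) :
    uconfSetoid n E (adjoinFarPoint n e he x) (adjoinFarPoint n e he y) := by
  obtain ⟨σ, h⟩ := h
  refine ⟨σ, funext fun i => ?_⟩
  have hsum : ∑ i, ‖y.1 (σ i)‖ = ∑ i, ‖y.1 i‖ := Equiv.sum_comp σ fun i => ‖y.1 i‖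
  induction i using Fin.cases <;> simp [adjoinFarPoint, extendPerm, h, hsum]

theorem section_unordered_exists_R2 (n : ℕ) (hn : 1 ≤ n) :
    ∃ t : Conf n (EuclideanSpace ℝ (Fin 2)) → UConf n (EuclideanSpace ℝ (Fin 2)),
      Continuous t ∧ ∀ x, forgetQ n (EuclideanSpace ℝ (Fin 2)) (t x) = x := by
  have he : ‖EuclideanSpace.single (0 : Fin 2) (1 : ℝ)‖ = 1 := by simp
  refine ⟨Quotient.map (adjoinFarPoint n _ he) fun _ _ => adjoinFarPoint_rel n _ he,
    (continuous_adjoinFarPoint n _ he).quotient_map' _, ?_⟩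
  rintro ⟨x⟩
  rfl
end
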